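/- arXiv:2203.06329 — 2 statements merged into one kernel-verified Lean document; each statement's English description precedes it below -/
import Mathlib

section
/- For each fixed ν ≥ 0, lim_{z→∞} (B(z,ν) − A(z,ν)) = 0. -/
open Real MeasureTheory Set Filter intervalIntegral

/-- Integral representation of the modified Bessel function `K₀`. -/
noncomputable def K0 (x : ℝ) : ℝ := ∫ t in Ioi (0:ℝ), Real.exp (-x * Real.cosh t)

/-- Bessel modulus squared, via Nicholson's formula. -/
noncomputable def M2 (ν z : ℝ) : ℝ :=
  (8 / π ^ 2) * ∫ t in Ioi (0:ℝ), K0 (2 * z * Real.sinh t) * Real.cosh (2 * ν * t)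

/-- The Bessel phase. -/
noncomputable def phase (ν z : ℝ) : ℝ :=
  -(π / 2) + (2 / π) * ∫ u in (0:ℝ)..z, 1 / (u * M2 ν u)

/-- `A(z,ν) = (1/π)(θ_ν(z) + π/2)`. -/
noncomputable def A (z ν : ℝ) : ℝ := (1 / π) * (phase ν z + π / 2)

/-- `B(z,ν) = (1/π)(√(z²−ν²) − ν·arccos(ν/z)) + 1/4`. -/
noncomputable def B (z ν : ℝ) : ℝ :=
  (1 / π) * (Real.sqrt (z ^ 2 - ν ^ 2) - ν * Real.arccos (ν / z)) + 1 / 4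

lemma sq_div_four_le_cosh (t : ℝ) : t ^ 2 / 4 ≤ Real.cosh t := by
  rw [← Real.cosh_abs, ← sq_abs]
  have h := Real.quadratic_le_exp_of_nonneg (abs_nonneg t)
  have h2 := Real.add_one_le_exp (-|t|)
  rw [Real.cosh_eq]
  nlinarith

lemma sq_div_four_le_sinh {a : ℝ} (ha : 0 ≤ a) : a ^ 2 / 4 ≤ Real.sinh a := by
  have h := Real.quadratic_le_exp_of_nonneg ha
  have h2 : Real.exp (-a) ≤ 1 := by rw [Real.exp_le_one_iff]; linarith
  rw [Real.sinh_eq]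
  nlinarith

lemma exp_mul_exp_neg_cosh_le {x : ℝ} (hx : 0 < x) (κ t : ℝ) :
    Real.exp (κ * |t|) * Real.exp (-x * Real.cosh t) ≤
      Real.exp (2 * κ ^ 2 / x) * Real.exp (-(x / 8) * t ^ 2) := by
  rw [← Real.exp_add, ← Real.exp_add, Real.exp_le_exp]
  have h := sq_div_four_le_cosh t
  have h1 : κ * |t| ≤ x / 8 * t ^ 2 + 2 * κ ^ 2 / x := by
    have : x / 8 * t ^ 2 + 2 * κ ^ 2 / x - κ * |t| = (x * |t| - 4 * κ) ^ 2 / (8 * x) := by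
      rw [← sq_abs t]; field_simp; ring
    have h3 : 0 ≤ (x * |t| - 4 * κ) ^ 2 / (8 * x) := by positivity
    linarith
  nlinarith

lemma exp_mul_exp_neg_sinh_le {x : ℝ} (hx : 0 < x) (κ : ℝ) {a : ℝ} (ha : 0 ≤ a) :
    Real.exp (κ * a) * Real.exp (-x * Real.sinh a) ≤
      Real.exp (2 * κ ^ 2 / x) * Real.exp (-(x / 8) * a ^ 2) := by
  rw [← Real.exp_add, ← Real.exp_add, Real.exp_le_exp]
  have h := sq_div_four_le_sinh ha
  have h1 : κ * a ≤ x / 8 * a ^ 2 + 2 * κ ^ 2 / x := by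
    have : x / 8 * a ^ 2 + 2 * κ ^ 2 / x - κ * a = (x * a - 4 * κ) ^ 2 / (8 * x) := by
      field_simp; ring
    have h3 : 0 ≤ (x * a - 4 * κ) ^ 2 / (8 * x) := by positivity
    linarith
  nlinarith

lemma integrable_of_norm_le_exp_neg_cosh {E : Type*} [NormedAddCommGroup E] {F : ℝ → E} {x : ℝ}
    (hx : 0 < x) (κ : ℝ) (C : ℝ) (hF : Continuous F)
    (h : ∀ t, ‖F t‖ ≤ C * (Real.exp (κ * |t|) * Real.exp (-x * Real.cosh t))) :
    Integrable F := by
  have hC : 0 ≤ C := by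
    have h0 := (norm_nonneg _).trans (h 0)
    have : 0 < Real.exp (κ * |(0:ℝ)|) * Real.exp (-x * Real.cosh 0) := by positivity
    exact nonneg_of_mul_nonneg_left h0 this
  refine Integrable.mono'
    (g := fun t => C * (Real.exp (2 * κ ^ 2 / x) * Real.exp (-(x / 8) * t ^ 2)))
    (((integrable_exp_neg_mul_sq (by positivity : 0 < x / 8)).const_mul _).const_mul _)
    hF.aestronglyMeasurable (Eventually.of_forall fun t => (h t).trans ?_)
  exact mul_le_mul_of_nonneg_left (exp_mul_exp_neg_cosh_le hx κ t) hC

lemma cosh_le_exp_abs (t : ℝ) : Real.cosh t ≤ Real.exp |t| := by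
  rw [← Real.cosh_abs, Real.cosh_eq]
  have : Real.exp (-|t|) ≤ Real.exp |t| := Real.exp_le_exp.2 (by linarith [abs_nonneg t])
  linarith

/-- The modified Bessel function `K₁`, through its integral representation. -/
noncomputable def K1 (x : ℝ) : ℝ :=
  ∫ t in Ioi (0:ℝ), Real.cosh t * Real.exp (-x * Real.cosh t)

lemma integrable_cosh_pow_mul_exp (j : ℕ) {x : ℝ} (hx : 0 < x) :
    Integrable (fun t : ℝ => Real.cosh t ^ j * Real.exp (-x * Real.cosh t)) := by
  refine integrable_of_norm_le_exp_neg_cosh hx j 1 (by fun_prop) fun t => ?_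
  have := Real.cosh_pos t
  rw [Real.norm_of_nonneg (by positivity), one_mul, Real.exp_nat_mul]
  gcongr
  exact cosh_le_exp_abs t

lemma hasDerivAt_integral_cosh_pow (j : ℕ) {x : ℝ} (hx : 0 < x) :
    HasDerivAt (fun y => ∫ t in Ioi (0:ℝ), Real.cosh t ^ j * Real.exp (-y * Real.cosh t))
      (-∫ t in Ioi (0:ℝ), Real.cosh t ^ (j + 1) * Real.exp (-x * Real.cosh t)) x := by
  rw [← MeasureTheory.integral_neg]
  refine (_root_.hasDerivAt_integral_of_dominated_loc_of_deriv_le (s := Ioi (x / 2))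
    (μ := volume.restrict (Ioi 0))
    (F := fun y t => Real.cosh t ^ j * Real.exp (-y * Real.cosh t))
    (F' := fun y t => -(Real.cosh t ^ (j + 1) * Real.exp (-y * Real.cosh t)))
    (bound := fun t => Real.cosh t ^ (j + 1) * Real.exp (-(x / 2) * Real.cosh t))
    (Ioi_mem_nhds (by linarith)) (Eventually.of_forall fun y => ?_)
    (integrable_cosh_pow_mul_exp j hx).integrableOn ?_ ?_
    (integrable_cosh_pow_mul_exp (j + 1) (half_pos hx)).integrableOn ?_).2
  · exact Continuous.aestronglyMeasurable (by fun_prop)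
  · exact Continuous.aestronglyMeasurable (by fun_prop)
  · refine Eventually.of_forall fun t y hy => ?_
    have := Real.cosh_pos t
    rw [norm_neg, Real.norm_of_nonneg (by positivity)]
    gcongr
    exact (mem_Ioi.1 hy).le
  · refine Eventually.of_forall fun t y hy => ?_
    have h := (((hasDerivAt_id y).neg.mul_const (Real.cosh t)).exp).const_mul (Real.cosh t ^ j)
    refine h.congr_deriv ?_
    simp only [id, Pi.neg_apply]
    ring

lemma hasDerivAt_K0 {x : ℝ} (hx : 0 < x) : HasDerivAt K0 (-K1 x) x := by
  have h : K0 = fun y => ∫ t in Ioi (0:ℝ), Real.cosh t ^ 0 * Real.exp (-y * Real.cosh t) := by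
    ext y; simp [K0]
  rw [h]
  simpa [K1] using hasDerivAt_integral_cosh_pow 0 hx

lemma continuousOn_K0 : ContinuousOn K0 (Ioi 0) := fun _ hx =>
  (hasDerivAt_K0 hx).continuousAt.continuousWithinAt

lemma continuousOn_K1 : ContinuousOn K1 (Ioi 0) := fun x hx => by
  have h : K1 = fun y => ∫ t in Ioi (0:ℝ), Real.cosh t ^ 1 * Real.exp (-y * Real.cosh t) := by
    ext y; simp [K1]
  rw [h]
  exact (hasDerivAt_integral_cosh_pow 1 hx).continuousAt.continuousWithinAt

lemma integrable_K0_integrand {x : ℝ} (hx : 0 < x) :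
    Integrable (fun t : ℝ => Real.exp (-x * Real.cosh t)) := by
  simpa using integrable_cosh_pow_mul_exp 0 hx

lemma integrable_K1_integrand {x : ℝ} (hx : 0 < x) :
    Integrable (fun t : ℝ => Real.cosh t * Real.exp (-x * Real.cosh t)) := by
  simpa using integrable_cosh_pow_mul_exp 1 hx

lemma K0_nonneg (x : ℝ) : 0 ≤ K0 x := integral_nonneg fun _ => (Real.exp_pos _).le

lemma K1_nonneg (x : ℝ) : 0 ≤ K1 x :=
  integral_nonneg fun t => mul_nonneg (Real.cosh_pos t).le (Real.exp_pos _).le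

lemma K0_anti {x y : ℝ} (hx : 0 < x) (hxy : x ≤ y) : K0 y ≤ K0 x := by
  refine setIntegral_mono (integrable_K0_integrand (hx.trans_le hxy)).integrableOn
    (integrable_K0_integrand hx).integrableOn fun t => ?_
  have := Real.cosh_pos t
  simp only
  gcongr

lemma mul_exp_le_K0 {x T : ℝ} (hx : 0 < x) (hT : 0 ≤ T) :
    T * Real.exp (-x * Real.cosh T) ≤ K0 x := by
  have h1 : ∫ t in Ioc 0 T, Real.exp (-x * Real.cosh T) = T * Real.exp (-x * Real.cosh T) := by
    simp [hT]
  rw [← h1]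
  calc _ ≤ ∫ t in Ioc 0 T, Real.exp (-x * Real.cosh t) := by
        refine setIntegral_mono_on (by simp) (integrable_K0_integrand hx).integrableOn
          measurableSet_Ioc fun t ht => ?_
        have : Real.cosh t ≤ Real.cosh T := by
          rw [Real.cosh_le_cosh, abs_of_pos ht.1, abs_of_nonneg hT]; exact ht.2
        have := mul_le_mul_of_nonneg_left this hx.le
        rw [Real.exp_le_exp]
        linarith
    _ ≤ _ := by
        refine setIntegral_mono_set (integrable_K0_integrand hx).integrableOn ?_ ?_
        · exact Eventually.of_forall fun _ => (Real.exp_pos _).le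
        · exact Ioc_subset_Ioi_self.eventuallyLE

lemma K0_pos {x : ℝ} (hx : 0 < x) : 0 < K0 x :=
  lt_of_lt_of_le (by positivity) (mul_exp_le_K0 hx zero_le_one)

lemma tendsto_K0_nhdsGT_zero : Tendsto K0 (nhdsWithin 0 (Ioi 0)) atTop := by
  refine tendsto_atTop.2 fun b => ?_
  have hT : 0 ≤ |b| + 1 := by positivity
  have hc : Tendsto (fun x : ℝ => (|b| + 1) * Real.exp (-x * Real.cosh (|b| + 1)))
      (nhdsWithin 0 (Ioi 0)) (nhds (|b| + 1)) := by
    have : Continuous fun x : ℝ => (|b| + 1) * Real.exp (-x * Real.cosh (|b| + 1)) := by fun_prop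
    have h := (this.tendsto 0).mono_left (nhdsWithin_le_nhds (s := Ioi 0))
    simpa using h
  filter_upwards [hc.eventually_const_lt (show b < |b| + 1 by linarith [le_abs_self b]),
    self_mem_nhdsWithin] with x h1 h2
  exact h1.le.trans (mul_exp_le_K0 h2 hT)

lemma K0_le_K1 {x : ℝ} (hx : 0 < x) : K0 x ≤ K1 x := by
  refine setIntegral_mono (integrable_K0_integrand hx).integrableOn
    (integrable_K1_integrand hx).integrableOn fun t => ?_
  exact le_mul_of_one_le_left (Real.exp_pos _).le (Real.one_le_cosh t)

lemma integral_Ioi_deriv_eq {f f' : ℝ → ℝ} (hderiv : ∀ x ∈ Ici (0:ℝ), HasDerivAt f (f' x) x)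
    (hf' : IntegrableOn f' (Ioi 0)) (hf : IntegrableOn f (Ioi 0)) :
    ∫ x in Ioi (0:ℝ), f' x = -f 0 := by
  rw [integral_Ioi_of_hasDerivAt_of_tendsto' hderiv hf'
    (tendsto_zero_of_hasDerivAt_of_integrableOn_Ioi
      (fun x hx => hderiv x (mem_Ioi.1 hx).le) hf' hf), zero_sub]

lemma integrable_sinh_mul_exp {x : ℝ} (hx : 0 < x) :
    Integrable (fun t : ℝ => Real.sinh t * Real.exp (-x * Real.cosh t)) := by
  refine integrable_of_norm_le_exp_neg_cosh hx 1 1 (by fun_prop) fun t => ?_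
  rw [norm_mul, Real.norm_of_nonneg (Real.exp_pos _).le, one_mul, one_mul, Real.norm_eq_abs,
    Real.abs_sinh]
  gcongr
  exact (Real.sinh_lt_cosh _).le.trans (by simpa using cosh_le_exp_abs |t|)

lemma mul_integral_sinh_mul_exp {x : ℝ} (hx : 0 < x) :
    x * ∫ t in Ioi (0:ℝ), Real.sinh t * Real.exp (-x * Real.cosh t) = Real.exp (-x) := by
  have h := integral_Ioi_deriv_eq (f := fun t => Real.exp (-x * Real.cosh t))
    (f' := fun t => -x * (Real.sinh t * Real.exp (-x * Real.cosh t)))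
    (fun t _ => (((Real.hasDerivAt_cosh t).const_mul (-x)).exp).congr_deriv (by ring))
    ((integrable_sinh_mul_exp hx).const_mul _).integrableOn
    (integrable_K0_integrand hx).integrableOn
  rw [MeasureTheory.integral_const_mul] at h
  simp only [Real.cosh_zero, mul_one] at h
  linarith

lemma exp_neg_le_mul_K1 {x : ℝ} (hx : 0 < x) : Real.exp (-x) ≤ x * K1 x := by
  rw [← mul_integral_sinh_mul_exp hx]
  refine mul_le_mul_of_nonneg_left (setIntegral_mono (integrable_sinh_mul_exp hx).integrableOn
    (integrable_K1_integrand hx).integrableOn fun t => ?_) hx.le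
  simp only
  gcongr
  exact (Real.sinh_lt_cosh t).le

lemma mul_K1_le {x : ℝ} (hx : 0 < x) : x * K1 x ≤ (1 + x) * Real.exp (-x) := by
  have hi : IntegrableOn (fun t : ℝ => Real.exp (-t) * Real.exp (-x)) (Ioi 0) :=
    (integrableOn_exp_neg_Ioi 0).mul_const _
  have h : K1 x ≤ ∫ t in Ioi (0:ℝ), (Real.sinh t * Real.exp (-x * Real.cosh t)
      + Real.exp (-t) * Real.exp (-x)) := by
    refine setIntegral_mono (integrable_K1_integrand hx).integrableOn
      ((integrable_sinh_mul_exp hx).integrableOn.add hi) fun t => ?_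
    have h1 : Real.cosh t = Real.sinh t + Real.exp (-t) := by
      rw [Real.cosh_eq, Real.sinh_eq]; ring
    have h2 : Real.exp (-x * Real.cosh t) ≤ Real.exp (-x) := by
      rw [Real.exp_le_exp]; nlinarith [Real.one_le_cosh t]
    calc Real.cosh t * Real.exp (-x * Real.cosh t)
        = Real.sinh t * Real.exp (-x * Real.cosh t)
          + Real.exp (-t) * Real.exp (-x * Real.cosh t) := by
          rw [← add_mul, ← h1]
      _ ≤ _ := by gcongr
  rw [integral_add (integrable_sinh_mul_exp hx).integrableOn hi,
    MeasureTheory.integral_mul_const, integral_exp_neg_Ioi_zero, one_mul] at h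
  have := mul_le_mul_of_nonneg_left h hx.le
  rw [mul_add, mul_integral_sinh_mul_exp hx] at this
  linarith

lemma mul_K1_le_one {x : ℝ} (hx : 0 < x) : x * K1 x ≤ 1 := by
  refine (mul_K1_le hx).trans ?_
  rw [Real.exp_neg, ← div_eq_mul_inv, div_le_one (Real.exp_pos _)]
  linarith [Real.add_one_le_exp x]

lemma mul_K1_le_two_mul_exp {x : ℝ} (hx : 0 < x) : x * K1 x ≤ 2 * Real.exp (-(x / 2)) := by
  refine (mul_K1_le hx).trans ?_
  have h1 : Real.exp (-x) = Real.exp (-(x / 2)) * Real.exp (-(x / 2)) := by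
    rw [← Real.exp_add]; ring_nf
  have h2 : (1 + x) * Real.exp (-(x / 2)) ≤ 2 := by
    rw [Real.exp_neg, ← div_eq_mul_inv, div_le_iff₀ (Real.exp_pos _)]
    linarith [Real.add_one_le_exp (x / 2)]
  rw [h1, ← mul_assoc]
  exact mul_le_mul_of_nonneg_right h2 (Real.exp_pos _).le

lemma integrable_exp_div_one_add_cosh {x : ℝ} (hx : 0 < x) :
    Integrable (fun t : ℝ => Real.exp (-x * Real.cosh t) / (1 + Real.cosh t)) := by
  refine (integrable_K0_integrand hx).mono' ?_ (Eventually.of_forall fun t => ?_)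
  · refine Continuous.aestronglyMeasurable (Continuous.div (by fun_prop) (by fun_prop) fun t => ?_)
    linarith [Real.cosh_pos t]
  · have := Real.cosh_pos t
    rw [Real.norm_of_nonneg (by positivity)]
    exact div_le_self (Real.exp_pos _).le (by linarith)

lemma mul_K1_sub_K0 {x : ℝ} (hx : 0 < x) :
    x * (K1 x - K0 x) = ∫ t in Ioi (0:ℝ), Real.exp (-x * Real.cosh t) / (1 + Real.cosh t) := by
  have hI := integrable_exp_div_one_add_cosh hx
  have hd : ∀ t : ℝ, HasDerivAt
      (fun t => Real.sinh t * (Real.exp (-x * Real.cosh t) / (1 + Real.cosh t)))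
      (Real.exp (-x * Real.cosh t) / (1 + Real.cosh t) - x * (Real.cosh t *
        Real.exp (-x * Real.cosh t) - Real.exp (-x * Real.cosh t))) t := fun t => by
    have hne : 1 + Real.cosh t ≠ 0 := by linarith [Real.cosh_pos t]
    have h := (Real.hasDerivAt_sinh t).mul ((((Real.hasDerivAt_cosh t).const_mul (-x)).exp).div
      ((Real.hasDerivAt_cosh t).const_add 1) hne)
    refine h.congr_deriv ?_
    have hs := Real.cosh_sq t
    simp only [Pi.div_apply]
    field_simp
    rw [show Real.sinh t ^ 2 = Real.cosh t ^ 2 - 1 by linarith]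
    ring
  have hdi1 : Integrable fun t : ℝ => x * (Real.cosh t * Real.exp (-x * Real.cosh t)
      - Real.exp (-x * Real.cosh t)) :=
    ((integrable_K1_integrand hx).sub (integrable_K0_integrand hx)).const_mul x
  have h := integral_Ioi_deriv_eq (fun t _ => hd t) (hI.sub hdi1).integrableOn ?_
  · simp only [Real.sinh_zero, zero_mul, neg_zero] at h
    rw [integral_sub hI.integrableOn hdi1.integrableOn, sub_eq_zero] at h
    rw [h, K0, K1, ← integral_sub (integrable_K1_integrand hx).integrableOn
      (integrable_K0_integrand hx).integrableOn, ← MeasureTheory.integral_const_mul]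
  · refine ((integrable_sinh_mul_exp hx).norm.mono' ?_
      (Eventually.of_forall fun t => ?_)).integrableOn
    · refine Continuous.aestronglyMeasurable (Continuous.mul (by fun_prop)
        (Continuous.div (by fun_prop) (by fun_prop) fun t => ?_))
      linarith [Real.cosh_pos t]
    · have := Real.cosh_pos t
      rw [norm_mul, norm_mul]
      refine mul_le_mul_of_nonneg_left ?_ (norm_nonneg _)
      rw [Real.norm_of_nonneg (by positivity), Real.norm_of_nonneg (by positivity)]
      exact div_le_self (Real.exp_pos _).le (by linarith)

lemma mul_K1_sub_K0_le {x : ℝ} (hx : 0 < x) : x * (K1 x - K0 x) ≤ K0 x / 2 := by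
  rw [mul_K1_sub_K0 hx, K0, ← MeasureTheory.integral_div]
  refine setIntegral_mono (integrable_exp_div_one_add_cosh hx).integrableOn
    ((integrable_K0_integrand hx).div_const 2).integrableOn fun t => ?_
  simp only
  gcongr
  linarith [Real.one_le_cosh t]

lemma le_mul_K1_sub_K0 {x : ℝ} (hx : 0 < x) :
    K0 x / 2 - K0 x / (8 * x) ≤ x * (K1 x - K0 x) := by
  have h : K0 x / 2 - (K1 x - K0 x) / 4 ≤ x * (K1 x - K0 x) := by
    have i0 := integrable_K0_integrand hx
    have i1 := integrable_K1_integrand hx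
    have i2 : Integrable fun t : ℝ => (Real.cosh t * Real.exp (-x * Real.cosh t)
      - Real.exp (-x * Real.cosh t)) / 4 := (i1.sub i0).div_const 4
    rw [mul_K1_sub_K0 hx, K0, K1, ← integral_sub i1.integrableOn i0.integrableOn,
      ← MeasureTheory.integral_div, ← MeasureTheory.integral_div,
      ← integral_sub (i0.div_const 2).integrableOn i2.integrableOn]
    refine setIntegral_mono ((i0.div_const 2).sub i2).integrableOn
      (integrable_exp_div_one_add_cosh hx).integrableOn fun t => ?_
    have h1 := Real.one_le_cosh t
    simp only
    rw [le_div_iff₀ (by linarith)]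
    nlinarith [mul_nonneg (Real.exp_pos (-x * Real.cosh t)).le (sq_nonneg (Real.cosh t - 1))]
  have h2 : K1 x - K0 x ≤ K0 x / (2 * x) := by
    rw [le_div_iff₀ (by positivity)]
    linarith [mul_K1_sub_K0_le hx]
  have h3 : K0 x / (8 * x) = K0 x / (2 * x) / 4 := by field_simp; ring
  linarith

/-- The argument of the Bessel functions in Nicholson's formula along a ray. -/
noncomputable def nicholsonArg (r c a : ℝ) : ℝ := 2 * r * √(Real.sinh a ^ 2 + c ^ 2)

section
variable {r c : ℝ}

lemma nicholsonArg_pos (hr : 0 < r) (hc : 0 < c) (a : ℝ) : 0 < nicholsonArg r c a := by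
  unfold nicholsonArg; positivity

lemma continuous_nicholsonArg : Continuous (nicholsonArg r c) := by
  unfold nicholsonArg; fun_prop

lemma nicholsonArg_neg (a : ℝ) : nicholsonArg r c (-a) = nicholsonArg r c a := by
  simp [nicholsonArg, Real.sinh_neg]

lemma le_nicholsonArg (hr : 0 < r) (a : ℝ) : 2 * r * c ≤ nicholsonArg r c a := by
  unfold nicholsonArg
  gcongr
  exact Real.le_sqrt_of_sq_le (by nlinarith [sq_nonneg (Real.sinh a)])

lemma sinh_le_nicholsonArg (hr : 0 < r) (a : ℝ) :
    2 * r * Real.sinh a ≤ nicholsonArg r c a := by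
  unfold nicholsonArg
  gcongr
  exact Real.le_sqrt_of_sq_le (by nlinarith [sq_nonneg c])

lemma cosh_le_nicholsonArg (hr : 0 < r) (hc1 : c ≤ 1) (hc : 0 < c) (a : ℝ) :
    2 * r * c * Real.cosh a ≤ nicholsonArg r c a := by
  unfold nicholsonArg
  rw [mul_assoc (2 * r)]
  gcongr
  refine Real.le_sqrt_of_sq_le ?_
  have := Real.cosh_sq a
  have : c ^ 2 ≤ 1 := by nlinarith
  nlinarith [sq_nonneg (Real.sinh a)]

lemma nicholsonArg_mono {r' c' : ℝ} (hr' : 0 ≤ r') (hr : r ≤ r') (hc0 : 0 ≤ c) (hc : c ≤ c')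
    (a : ℝ) :
    nicholsonArg r c a ≤ nicholsonArg r' c' a := by
  unfold nicholsonArg
  gcongr

lemma integrable_comp_nicholsonArg_mul (hr : 0 < r) (hc : 0 < c) (hc1 : c ≤ 1) {k : ℝ → ℝ}
    (hk : ContinuousOn k (Ioi 0)) {D : ℝ}
    (hD : ∀ x, 2 * r * c ≤ x → |k x| ≤ D * Real.exp (-(x / 2)))
    {F : ℝ → ℝ} (hF : Continuous F) {C κ : ℝ} (hFb : ∀ a, |F a| ≤ C * Real.exp (κ * |a|)) :
    Integrable fun a => k (nicholsonArg r c a) * F a := by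
  have hx : 0 < r * c := by positivity
  have hD0 : 0 ≤ D := by
    have := (abs_nonneg _).trans (hD _ le_rfl)
    exact nonneg_of_mul_nonneg_left this (Real.exp_pos _)
  refine integrable_of_norm_le_exp_neg_cosh hx κ (D * C) ?_ fun a => ?_
  · exact (hk.comp_continuous continuous_nicholsonArg
      fun a => nicholsonArg_pos hr hc a).mul hF
  · rw [norm_mul, Real.norm_eq_abs, Real.norm_eq_abs]
    calc _ ≤ (D * Real.exp (-(nicholsonArg r c a / 2))) * (C * Real.exp (κ * |a|)) := by
          gcongr
          · exact hD _ (le_nicholsonArg hr a)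
          · exact hFb a
      _ ≤ (D * Real.exp (-(r * c) * Real.cosh a)) * (C * Real.exp (κ * |a|)) := by
          have h0 : 0 ≤ C * Real.exp (κ * |a|) := (abs_nonneg _).trans (hFb a)
          gcongr
          linarith [cosh_le_nicholsonArg hr hc1 hc a]
      _ = _ := by ring

lemma abs_mul_K1_le {x : ℝ} (hx : 0 < x) : |x * K1 x| ≤ 2 * Real.exp (-(x / 2)) := by
  rw [abs_of_nonneg (mul_nonneg hx.le (K1_nonneg x))]
  exact mul_K1_le_two_mul_exp hx

lemma abs_K1_le {x₀ x : ℝ} (hx₀ : 0 < x₀) (hx : x₀ ≤ x) :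
    |K1 x| ≤ 2 / x₀ * Real.exp (-(x / 2)) := by
  have h := mul_K1_le_two_mul_exp (hx₀.trans_le hx)
  rw [abs_of_nonneg (K1_nonneg x), div_mul_eq_mul_div, le_div_iff₀ hx₀]
  nlinarith [K1_nonneg x]

lemma abs_K0_le {x₀ x : ℝ} (hx₀ : 0 < x₀) (hx : x₀ ≤ x) :
    |K0 x| ≤ 2 / x₀ * Real.exp (-(x / 2)) := by
  refine le_trans ?_ (abs_K1_le hx₀ hx)
  rw [abs_of_nonneg (K1_nonneg x), abs_of_nonneg (K0_nonneg x)]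
  exact K0_le_K1 (hx₀.trans_le hx)

lemma abs_K1_div_le {x₀ x : ℝ} (hx₀ : 0 < x₀) (hx : x₀ ≤ x) :
    |K1 x / x| ≤ 2 / x₀ / x₀ * Real.exp (-(x / 2)) := by
  have h := abs_K1_le hx₀ hx
  have hx' := hx₀.trans_le hx
  rw [abs_div, abs_of_pos hx', div_mul_eq_mul_div, div_le_div_iff₀ hx' hx₀]
  exact mul_le_mul h hx hx₀.le (by positivity)

lemma continuousOn_K1_div : ContinuousOn (fun x => K1 x / x) (Ioi 0) :=
  continuousOn_K1.div continuousOn_id fun _ hx => ne_of_gt hx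

lemma continuousOn_mul_K1 : ContinuousOn (fun x => x * K1 x) (Ioi 0) :=
  continuousOn_id.mul continuousOn_K1

variable {F : ℝ → ℝ} {C κ : ℝ}

lemma integrable_K0_nicholsonArg (hr : 0 < r) (hc : 0 < c) (hc1 : c ≤ 1) (hF : Continuous F)
    (hFb : ∀ a, |F a| ≤ C * Real.exp (κ * |a|)) :
    Integrable fun a => K0 (nicholsonArg r c a) * F a :=
  integrable_comp_nicholsonArg_mul hr hc hc1 continuousOn_K0
    (fun _ hx => abs_K0_le (by positivity) hx) hF hFb

lemma integrable_K1_nicholsonArg (hr : 0 < r) (hc : 0 < c) (hc1 : c ≤ 1) (hF : Continuous F)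
    (hFb : ∀ a, |F a| ≤ C * Real.exp (κ * |a|)) :
    Integrable fun a => K1 (nicholsonArg r c a) * F a :=
  integrable_comp_nicholsonArg_mul hr hc hc1 continuousOn_K1
    (fun _ hx => abs_K1_le (by positivity) hx) hF hFb

lemma integrable_mul_K1_nicholsonArg (hr : 0 < r) (hc : 0 < c) (hc1 : c ≤ 1) (hF : Continuous F)
    (hFb : ∀ a, |F a| ≤ C * Real.exp (κ * |a|)) :
    Integrable fun a => nicholsonArg r c a * K1 (nicholsonArg r c a) * F a :=
  integrable_comp_nicholsonArg_mul hr hc hc1 continuousOn_mul_K1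
    (fun _ hx => abs_mul_K1_le ((by positivity : 0 < 2 * r * c).trans_le hx)) hF hFb

lemma integrable_K1_div_nicholsonArg (hr : 0 < r) (hc : 0 < c) (hc1 : c ≤ 1) (hF : Continuous F)
    (hFb : ∀ a, |F a| ≤ C * Real.exp (κ * |a|)) :
    Integrable fun a => K1 (nicholsonArg r c a) / nicholsonArg r c a * F a :=
  integrable_comp_nicholsonArg_mul hr hc hc1 continuousOn_K1_div
    (fun _ hx => abs_K1_div_le (by positivity) hx) hF hFb

lemma abs_cosh_mul_le (ν a : ℝ) : |Real.cosh (2 * ν * a)| ≤ 1 * Real.exp (|2 * ν| * |a|) := by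
  rw [abs_of_pos (Real.cosh_pos _), ← abs_mul, one_mul]
  exact cosh_le_exp_abs _

lemma abs_exp_mul_le (ν a : ℝ) : |Real.exp (2 * ν * a)| ≤ 1 * Real.exp (|2 * ν| * |a|) := by
  rw [abs_of_pos (Real.exp_pos _), ← abs_mul, one_mul, Real.exp_le_exp]
  exact le_abs_self _

end

/-- Nicholson-type integrals: `|K_ν(w)|² = 2 nicholsonP`, with `w = r e^{iθ}`, `c = cos θ`. -/
noncomputable def nicholsonP (ν r c : ℝ) : ℝ :=
  ∫ a in Ioi (0:ℝ), K0 (nicholsonArg r c a) * Real.cosh (2 * ν * a)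

/-- The integral giving the real part of the logarithmic derivative of `K_ν`. -/
noncomputable def nicholsonQ (ν r c : ℝ) : ℝ :=
  ∫ a in Ioi (0:ℝ), nicholsonArg r c a * K1 (nicholsonArg r c a) * Real.cosh (2 * ν * a)

/-- The integral giving the imaginary part of the logarithmic derivative of `K_ν`. -/
noncomputable def nicholsonS (ν r c : ℝ) : ℝ :=
  ∫ a in Ioi (0:ℝ), K1 (nicholsonArg r c a) / nicholsonArg r c a * Real.cosh (2 * ν * a)

lemma nicholsonP_pos {ν r c : ℝ} (hr : 0 < r) (hc : 0 < c) (hc1 : c ≤ 1) :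
    0 < nicholsonP ν r c := by
  refine (setIntegral_pos_iff_support_of_nonneg_ae ?_
    (integrable_K0_nicholsonArg hr hc hc1 (by fun_prop) (abs_cosh_mul_le ν)).integrableOn).2 ?_
  · exact Eventually.of_forall fun a => mul_nonneg (K0_nonneg _) (Real.cosh_pos _).le
  · have : (Function.support fun a => K0 (nicholsonArg r c a) * Real.cosh (2 * ν * a)) = univ := by
      ext a
      simp [(K0_pos (nicholsonArg_pos hr hc a)).ne', (Real.cosh_pos _).ne']
    simp [this]

lemma integral_even_mul_exp {G : ℝ → ℝ} (hG : ∀ a, G (-a) = G a) {ν : ℝ}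
    (hi : Integrable fun a => G a * Real.exp (2 * ν * a)) :
    ∫ a, G a * Real.exp (2 * ν * a) = 2 * ∫ a in Ioi (0:ℝ), G a * Real.cosh (2 * ν * a) := by
  have hi' : Integrable fun a => G a * Real.exp (-(2 * ν * a)) := by
    simpa [hG] using hi.comp_neg
  have h1 : ∫ a, G a * Real.exp (-(2 * ν * a)) = ∫ a, G a * Real.exp (2 * ν * a) := by
    rw [← integral_neg_eq_self (fun a => G a * Real.exp (2 * ν * a))]
    simp [hG]
  have h2 : ∫ a, G |a| * Real.cosh (2 * ν * |a|) = ∫ a, G a * Real.exp (2 * ν * a) := by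
    calc _ = ∫ a, (G a * Real.exp (2 * ν * a) + G a * Real.exp (-(2 * ν * a))) / 2 := by
          refine integral_congr_ae (Eventually.of_forall fun a => ?_)
          have e : G |a| = G a := by rcases abs_choice a with h | h <;> rw [h]; exact hG a
          have e2 : Real.cosh (2 * ν * |a|) = Real.cosh (2 * ν * a) := by
            rcases abs_choice a with h | h <;> rw [h]; rw [mul_neg, Real.cosh_neg]
          simp only [e, e2]
          rw [Real.cosh_eq]; ring
      _ = _ := by
          rw [MeasureTheory.integral_div, integral_add hi hi', h1]; ring
  rw [← h2, integral_comp_abs (f := fun a => G a * Real.cosh (2 * ν * a))]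

lemma HasDerivAt.comp_ofReal_add {F : ℂ → ℂ} {F' : ℂ} {b : ℝ} {w : ℂ}
    (h : HasDerivAt F F' (b + w)) : HasDerivAt (fun b : ℝ => F (b + w)) F' b :=
  (h.comp_add_const (b : ℂ) w).comp_ofReal

lemma HasDerivAt.comp_add_ofReal_mul_I {F : ℂ → ℂ} {F' : ℂ} {y : ℝ} {w : ℂ}
    (h : HasDerivAt F F' (w + y * Complex.I)) :
    HasDerivAt (fun y : ℝ => F (w + y * Complex.I)) (F' * Complex.I) y := by
  have h1 : HasDerivAt (fun z : ℂ => w + z * Complex.I) Complex.I (y : ℂ) := by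
    simpa using ((hasDerivAt_id (y : ℂ)).mul_const Complex.I).const_add w
  exact (HasDerivAt.comp (y : ℂ) h h1).comp_ofReal

lemma integral_add_mul_I_eq {F F' : ℂ → ℂ} (hF : ∀ z, HasDerivAt F (F' z) z)
    (hF' : Continuous F') {χ₁ : ℝ} {g : ℝ → ℝ} (hg : Integrable g)
    (hFg : ∀ b χ : ℝ, |χ| < χ₁ → ‖F (b + χ * Complex.I)‖ ≤ g b)
    (hFg' : ∀ b χ : ℝ, |χ| < χ₁ → ‖F' (b + χ * Complex.I)‖ ≤ g b) {χ : ℝ} (hχ : |χ| < χ₁) :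
    ∫ b : ℝ, F (b + χ * Complex.I) = ∫ b : ℝ, F b := by
  have hFc : Continuous F := continuous_iff_continuousAt.2 fun z => (hF z).continuousAt
  have hd : ∀ χ ∈ Ioo (-χ₁) χ₁,
      HasDerivAt (fun χ : ℝ => ∫ b : ℝ, F (b + χ * Complex.I)) 0 χ := by
    intro χ hχ
    have hχ' := abs_lt.2 hχ
    have hdi : Integrable fun b : ℝ => F (b + χ * Complex.I) :=
      hg.mono' (Continuous.aestronglyMeasurable (by fun_prop))
        (Eventually.of_forall fun b => hFg b χ hχ')
    have hdi' : Integrable fun b : ℝ => F' (b + χ * Complex.I) :=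
      hg.mono' (Continuous.aestronglyMeasurable (by fun_prop))
        (Eventually.of_forall fun b => hFg' b χ hχ')
    have hz : ∫ b : ℝ, F' (b + χ * Complex.I) * Complex.I = 0 := by
      rw [MeasureTheory.integral_mul_const, integral_eq_zero_of_hasDerivAt_of_integrable
        (f := fun b : ℝ => F (b + χ * Complex.I)) (fun b => ?_) hdi' hdi, zero_mul]
      exact (hF _).comp_ofReal_add
    rw [← hz]
    refine (_root_.hasDerivAt_integral_of_dominated_loc_of_deriv_le (s := Ioo (-χ₁) χ₁)
      (μ := volume) (F := fun (χ b : ℝ) => F (b + χ * Complex.I))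
      (F' := fun (χ b : ℝ) => F' (b + χ * Complex.I) * Complex.I) (bound := g)
      (Ioo_mem_nhds hχ.1 hχ.2) (Eventually.of_forall fun y => ?_) hdi ?_ ?_ hg ?_).2
    · exact Continuous.aestronglyMeasurable (by fun_prop)
    · exact Continuous.aestronglyMeasurable (by fun_prop)
    · exact Eventually.of_forall fun b y hy => by
        simpa using hFg' b y (abs_lt.2 hy)
    · refine Eventually.of_forall fun b y _ => ?_
      exact (hF _).comp_add_ofReal_mul_I
  have h0 : (0:ℝ) ∈ Ioo (-χ₁) χ₁ := by
    have := (abs_nonneg χ).trans_lt hχ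
    constructor <;> linarith
  have := isOpen_Ioo.is_const_of_deriv_eq_zero isPreconnected_Ioo
    (fun x hx => (hd x hx).differentiableAt.differentiableWithinAt)
    (fun x hx => (hd x hx).deriv) (abs_lt.1 hχ) h0
  simpa using this

lemma norm_exp_neg_mul_cosh (R b χ : ℝ) :
    ‖Complex.exp (-R * Complex.cosh (b + χ * Complex.I))‖ =
      Real.exp (-(R * Real.cos χ) * Real.cosh b) := by
  rw [Complex.norm_exp, Complex.cosh_add, Complex.cosh_mul_I, Complex.sinh_mul_I,
    ← Complex.ofReal_cosh, ← Complex.ofReal_sinh, ← Complex.ofReal_cos, ← Complex.ofReal_sin]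
  congr 1
  simp [-Complex.ofReal_cos, -Complex.ofReal_sin, -Complex.ofReal_sinh, -Complex.ofReal_cosh]
  ring

lemma norm_cosh_add_mul_I_le (b χ : ℝ) : ‖Complex.cosh (b + χ * Complex.I)‖ ≤ Real.cosh b := by
  rw [Complex.cosh_add, Complex.cosh_mul_I, Complex.sinh_mul_I,
    ← Complex.ofReal_cosh, ← Complex.ofReal_sinh, ← Complex.ofReal_cos, ← Complex.ofReal_sin]
  refine abs_le_of_sq_le_sq' ?_ (Real.cosh_pos b).le |>.2
  rw [Complex.sq_norm, Complex.normSq_apply]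
  simp [-Complex.ofReal_cos, -Complex.ofReal_sin, -Complex.ofReal_sinh, -Complex.ofReal_cosh]
  nlinarith [Real.cosh_sq b, Real.sin_sq_add_cos_sq χ, sq_nonneg (Real.sin χ)]

lemma norm_sinh_add_mul_I_le (b χ : ℝ) : ‖Complex.sinh (b + χ * Complex.I)‖ ≤ Real.cosh b := by
  rw [Complex.sinh_add, Complex.cosh_mul_I, Complex.sinh_mul_I,
    ← Complex.ofReal_cosh, ← Complex.ofReal_sinh, ← Complex.ofReal_cos, ← Complex.ofReal_sin]
  refine abs_le_of_sq_le_sq' ?_ (Real.cosh_pos b).le |>.2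
  rw [Complex.sq_norm, Complex.normSq_apply]
  simp [-Complex.ofReal_cos, -Complex.ofReal_sin, -Complex.ofReal_sinh, -Complex.ofReal_cosh]
  nlinarith [Real.cosh_sq b, Real.sin_sq_add_cos_sq χ, sq_nonneg (Real.cos χ)]

lemma exists_cos_lower_bound {χ : ℝ} (hχ : |χ| < π / 2) :
    ∃ χ₁ δ : ℝ, |χ| < χ₁ ∧ 0 < δ ∧ ∀ y : ℝ, |y| < χ₁ → δ ≤ Real.cos y := by
  refine ⟨(|χ| + π / 2) / 2, Real.cos ((|χ| + π / 2) / 2), by linarith,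
    Real.cos_pos_of_mem_Ioo ⟨by linarith [abs_nonneg χ, Real.pi_pos], by linarith⟩, fun y hy => ?_⟩
  rw [← Real.cos_abs y]
  exact Real.cos_le_cos_of_nonneg_of_le_pi (abs_nonneg y) (by linarith [Real.pi_pos]) hy.le

lemma norm_exp_neg_mul_cosh_le {R δ b y : ℝ} (hR : 0 < R) (h : δ ≤ Real.cos y) :
    ‖Complex.exp (-R * Complex.cosh (b + y * Complex.I))‖ ≤ Real.exp (-(R * δ) * Real.cosh b) := by
  rw [norm_exp_neg_mul_cosh]
  have := Real.cosh_pos b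
  gcongr

lemma integral_exp_shift {R χ : ℝ} (hR : 0 < R) (hχ : |χ| < π / 2) :
    ∫ b : ℝ, Complex.exp (-R * Complex.cosh (b + χ * Complex.I)) = (2 * K0 R : ℝ) := by
  obtain ⟨χ₁, δ, h1, hδ, h2⟩ := exists_cos_lower_bound hχ
  rw [integral_add_mul_I_eq (F := fun z => Complex.exp (-R * Complex.cosh z))
    (F' := fun z => Complex.exp (-R * Complex.cosh z) * (-R * Complex.sinh z))
    (g := fun b => (1 + R) * (Real.cosh b ^ 1 * Real.exp (-(R * δ) * Real.cosh b)))
    (fun z => ((Complex.hasDerivAt_cosh z).const_mul _).cexp) (by fun_prop)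
    ((integrable_cosh_pow_mul_exp 1 (by positivity)).const_mul _)
    (fun b y hy => ?_) (fun b y hy => ?_) h1]
  · have h3 := integral_comp_abs (f := fun b => Real.exp (-R * Real.cosh b))
    simp only [Real.cosh_abs] at h3
    rw [K0, ← h3, ← integral_complex_ofReal]
    simp
  · refine (norm_exp_neg_mul_cosh_le hR (h2 y hy)).trans ?_
    rw [pow_one, ← mul_assoc]
    refine le_mul_of_one_le_left (Real.exp_pos _).le ?_
    nlinarith [Real.one_le_cosh b]
  · rw [norm_mul, norm_mul, norm_neg, Complex.norm_real, Real.norm_of_nonneg hR.le]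
    calc _ ≤ Real.exp (-(R * δ) * Real.cosh b) * (R * Real.cosh b) := by
          gcongr
          · exact norm_exp_neg_mul_cosh_le hR (h2 y hy)
          · exact norm_sinh_add_mul_I_le b y
      _ ≤ _ := by
          have : 0 ≤ Real.cosh b * Real.exp (-(R * δ) * Real.cosh b) :=
            mul_nonneg (Real.cosh_pos b).le (Real.exp_pos _).le
          rw [pow_one]
          nlinarith

lemma integral_cosh_mul_exp_shift {R χ : ℝ} (hR : 0 < R) (hχ : |χ| < π / 2) :
    ∫ b : ℝ, Complex.cosh (b + χ * Complex.I) *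
      Complex.exp (-R * Complex.cosh (b + χ * Complex.I)) = (2 * K1 R : ℝ) := by
  obtain ⟨χ₁, δ, h1, hδ, h2⟩ := exists_cos_lower_bound hχ
  rw [integral_add_mul_I_eq (F := fun z => Complex.cosh z * Complex.exp (-R * Complex.cosh z))
    (F' := fun z => Complex.sinh z * Complex.exp (-R * Complex.cosh z) +
      Complex.cosh z * (Complex.exp (-R * Complex.cosh z) * (-R * Complex.sinh z)))
    (g := fun b => (1 + R) * (Real.cosh b ^ 2 * Real.exp (-(R * δ) * Real.cosh b)))
    (fun z => (Complex.hasDerivAt_cosh z).mul ((Complex.hasDerivAt_cosh z).const_mul _).cexp)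
    (by fun_prop) ((integrable_cosh_pow_mul_exp 2 (by positivity)).const_mul _)
    (fun b y hy => ?_) (fun b y hy => ?_) h1]
  · have h3 := integral_comp_abs (f := fun b => Real.cosh b * Real.exp (-R * Real.cosh b))
    simp only [Real.cosh_abs] at h3
    rw [K1, ← h3, ← integral_complex_ofReal]
    simp
  · have h4 := Real.one_le_cosh b
    rw [norm_mul]
    calc _ ≤ Real.cosh b * Real.exp (-(R * δ) * Real.cosh b) := by
          gcongr
          · exact norm_cosh_add_mul_I_le b y
          · exact norm_exp_neg_mul_cosh_le hR (h2 y hy)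
      _ ≤ _ := by
          rw [← mul_assoc]
          gcongr
          nlinarith
  · have h4 := Real.one_le_cosh b
    refine (norm_add_le _ _).trans ?_
    rw [norm_mul, norm_mul, norm_mul, norm_mul, norm_neg, Complex.norm_real,
      Real.norm_of_nonneg hR.le]
    calc _ ≤ Real.cosh b * Real.exp (-(R * δ) * Real.cosh b) +
          Real.cosh b * (Real.exp (-(R * δ) * Real.cosh b) * (R * Real.cosh b)) := by
          gcongr
          · exact norm_sinh_add_mul_I_le b y
          · exact norm_exp_neg_mul_cosh_le hR (h2 y hy)
          · exact norm_cosh_add_mul_I_le b y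
          · exact norm_exp_neg_mul_cosh_le hR (h2 y hy)
          · exact norm_sinh_add_mul_I_le b y
      _ = (Real.cosh b + R * Real.cosh b ^ 2) * Real.exp (-(R * δ) * Real.cosh b) := by ring
      _ ≤ ((1 + R) * Real.cosh b ^ 2) * Real.exp (-(R * δ) * Real.cosh b) := by
          gcongr
          nlinarith
      _ = _ := by ring

lemma integrable_cosh_mul_exp_shift {R χ : ℝ} (hR : 0 < R) (hχ : |χ| < π / 2) :
    Integrable fun b : ℝ => Complex.cosh (b + χ * Complex.I) *
      Complex.exp (-R * Complex.cosh (b + χ * Complex.I)) := by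
  have hc : 0 < Real.cos χ := Real.cos_pos_of_mem_Ioo (abs_lt.1 hχ |>.imp (by simpa using ·) id)
  refine integrable_of_norm_le_exp_neg_cosh (mul_pos hR hc) 1 1 (by fun_prop) fun b => ?_
  rw [norm_mul, norm_exp_neg_mul_cosh, one_mul, one_mul]
  gcongr
  exact (norm_cosh_add_mul_I_le b χ).trans (cosh_le_exp_abs b)

lemma integrable_sinh_mul_exp_shift {R χ : ℝ} (hR : 0 < R) (hχ : |χ| < π / 2) :
    Integrable fun b : ℝ => Complex.sinh (b + χ * Complex.I) *
      Complex.exp (-R * Complex.cosh (b + χ * Complex.I)) := by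
  have hc : 0 < Real.cos χ := Real.cos_pos_of_mem_Ioo (abs_lt.1 hχ |>.imp (by simpa using ·) id)
  refine integrable_of_norm_le_exp_neg_cosh (mul_pos hR hc) 1 1 (by fun_prop) fun b => ?_
  rw [norm_mul, norm_exp_neg_mul_cosh, one_mul, one_mul]
  gcongr
  exact (norm_sinh_add_mul_I_le b χ).trans (cosh_le_exp_abs b)

lemma integral_sinh_mul_exp_shift {R χ : ℝ} (hR : 0 < R) (hχ : |χ| < π / 2) :
    ∫ b : ℝ, Complex.sinh (b + χ * Complex.I) *
      Complex.exp (-R * Complex.cosh (b + χ * Complex.I)) = 0 := by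
  have hc : 0 < Real.cos χ := Real.cos_pos_of_mem_Ioo (abs_lt.1 hχ |>.imp (by simpa using ·) id)
  have h := integral_eq_zero_of_hasDerivAt_of_integrable
    (f := fun b : ℝ => Complex.exp (-R * Complex.cosh (b + χ * Complex.I)))
    (f' := fun b : ℝ => -R * (Complex.sinh (b + χ * Complex.I) *
      Complex.exp (-R * Complex.cosh (b + χ * Complex.I)))) (fun b => ?_)
    ((integrable_sinh_mul_exp_shift hR hχ).const_mul _) ?_
  · rw [MeasureTheory.integral_const_mul] at h
    simpa [hR.ne'] using h
  · have h := (((Complex.hasDerivAt_cosh (b + χ * Complex.I)).const_mul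
      (-R : ℂ)).cexp).comp_ofReal_add
    exact h.congr_deriv (by ring)
  · refine integrable_of_norm_le_exp_neg_cosh (mul_pos hR hc) 0 1 (by fun_prop) fun b => ?_
    rw [norm_exp_neg_mul_cosh]
    simp

section
variable {u : ℂ}

lemma cosh_shift_arg (u : ℂ) (b : ℝ) :
    (‖u‖ : ℂ) * Complex.cosh (b + u.arg * Complex.I) =
      u.re * Complex.cosh b + u.im * Complex.I * Complex.sinh b := by
  rw [Complex.cosh_add, Complex.cosh_mul_I, Complex.sinh_mul_I, ← Complex.ofReal_cos,
    ← Complex.ofReal_sin]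
  conv_rhs => rw [← Complex.norm_mul_cos_arg u, ← Complex.norm_mul_sin_arg u]
  push_cast
  ring

lemma exp_shift_arg (u : ℂ) (b : ℝ) :
    Complex.exp (-‖u‖ * Complex.cosh (b + u.arg * Complex.I)) =
      Complex.exp (-(u.re * Complex.cosh b + u.im * Complex.I * Complex.sinh b)) := by
  rw [neg_mul, cosh_shift_arg]

lemma integral_exp_neg_re_cosh_im_sinh (hu : 0 < u.re) :
    ∫ b : ℝ, Complex.exp (-(u.re * Complex.cosh b + u.im * Complex.I * Complex.sinh b)) =
      (2 * K0 ‖u‖ : ℝ) := by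
  have hu0 : 0 < ‖u‖ := norm_pos_iff.2 fun h => by simp [h] at hu
  have := integral_exp_shift hu0 (Complex.abs_arg_lt_pi_div_two_iff.2 (Or.inl hu))
  simpa only [exp_shift_arg] using this

lemma integral_cosh_add_mul_exp (hu : 0 < u.re) (a : ℝ) :
    ‖u‖ * ∫ b : ℝ, Complex.cosh (a + b) *
      Complex.exp (-(u.re * Complex.cosh b + u.im * Complex.I * Complex.sinh b)) =
      (u.re * Complex.cosh a - u.im * Complex.I * Complex.sinh a) * (2 * K1 ‖u‖ : ℝ) := by
  have hu0 : 0 < ‖u‖ := norm_pos_iff.2 fun h => by simp [h] at hu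
  have harg := Complex.abs_arg_lt_pi_div_two_iff.2 (Or.inl hu)
  rw [← MeasureTheory.integral_const_mul, ← integral_cosh_mul_exp_shift hu0 harg]
  have hs := integral_sinh_mul_exp_shift hu0 harg
  calc _ = ∫ b : ℝ, ((u.re * Complex.cosh a - u.im * Complex.I * Complex.sinh a) *
          (Complex.cosh (b + u.arg * Complex.I) *
            Complex.exp (-‖u‖ * Complex.cosh (b + u.arg * Complex.I)))
        + (u.re * Complex.sinh a - u.im * Complex.I * Complex.cosh a) *
          (Complex.sinh (b + u.arg * Complex.I) *
            Complex.exp (-‖u‖ * Complex.cosh (b + u.arg * Complex.I)))) := by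
        refine integral_congr_ae (Eventually.of_forall fun b => ?_)
        simp only
        rw [exp_shift_arg]
        have e : (‖u‖ : ℂ) * Complex.cosh (a + b) =
            (u.re * Complex.cosh a - u.im * Complex.I * Complex.sinh a) *
              Complex.cosh (b + u.arg * Complex.I) +
            (u.re * Complex.sinh a - u.im * Complex.I * Complex.cosh a) *
              Complex.sinh (b + u.arg * Complex.I) := by
          rw [Complex.cosh_add, Complex.cosh_add, Complex.sinh_add, Complex.cosh_mul_I,
            Complex.sinh_mul_I, ← Complex.ofReal_cos, ← Complex.ofReal_sin]
          have h1 : Complex.cos u.arg ^ 2 = 1 - Complex.sin u.arg ^ 2 := by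
            rw [← Complex.sin_sq_add_cos_sq u.arg]; ring
          conv_rhs => rw [← Complex.norm_mul_cos_arg u, ← Complex.norm_mul_sin_arg u]
          push_cast
          ring_nf
          simp only [Complex.I_sq, h1]
          ring
        rw [← mul_assoc, e]
        ring
    _ = _ := by
        rw [integral_add ((integrable_cosh_mul_exp_shift hu0 harg).const_mul _)
          ((integrable_sinh_mul_exp_shift hu0 harg).const_mul _),
          MeasureTheory.integral_const_mul, MeasureTheory.integral_const_mul, hs, mul_zero,
          add_zero]

end

lemma integral_mul_integral_eq {f g : ℝ → ℂ} (hf : Integrable f) (hg : Integrable g) :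
    (∫ t, f t) * ∫ t, g t = 2 * ∫ a, ∫ b, f (a + b) * g (a - b) := by
  have h := integral_convolution (μ := volume) (ContinuousLinearMap.mul ℝ ℂ) hf hg
  rw [ContinuousLinearMap.mul_apply'] at h
  rw [← h]
  have h2 := Measure.integral_comp_mul_left
    (fun x => convolution f g (ContinuousLinearMap.mul ℝ ℂ) volume x) (2:ℝ)
  have h3 : ∀ a : ℝ, convolution f g (ContinuousLinearMap.mul ℝ ℂ) volume (2 * a) =
      ∫ b, f (a + b) * g (a - b) := by
    intro a
    rw [convolution_def, ← integral_add_left_eq_self _ a]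
    refine integral_congr_ae (Eventually.of_forall fun b => ?_)
    simp only [ContinuousLinearMap.mul_apply']
    congr 2
    ring
  simp only [h3] at h2
  rw [h2]
  simp

/-- The integral representation of `2 K_ν(w)` on the right half-plane. -/
noncomputable def besselK (ν : ℝ) (w : ℂ) : ℂ :=
  ∫ t : ℝ, Complex.exp (-(w * Complex.cosh t) + ν * t)

/-- The integral representation of `-2 K_ν'(w)` on the right half-plane. -/
noncomputable def besselKDeriv (ν : ℝ) (w : ℂ) : ℂ :=
  ∫ t : ℝ, Complex.cosh t * Complex.exp (-(w * Complex.cosh t) + ν * t)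

lemma norm_besselK_integrand_le (ν : ℝ) (w : ℂ) (t : ℝ) :
    ‖Complex.exp (-(w * Complex.cosh t) + ν * t)‖ ≤
      Real.exp (|ν| * |t|) * Real.exp (-w.re * Real.cosh t) := by
  rw [Complex.norm_exp, ← Real.exp_add, Real.exp_le_exp, ← Complex.ofReal_cosh]
  simp only [Complex.add_re, Complex.neg_re, Complex.mul_re, Complex.ofReal_re, Complex.ofReal_im,
    mul_zero, sub_zero]
  have := le_abs_self (ν * t)
  rw [abs_mul] at this
  linarith

lemma norm_cosh_ofReal (t : ℝ) : ‖Complex.cosh t‖ = Real.cosh t := by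
  rw [← Complex.ofReal_cosh, Complex.norm_real, Real.norm_of_nonneg (Real.cosh_pos t).le]

lemma norm_besselKDeriv_integrand_le (ν : ℝ) (w : ℂ) (t : ℝ) :
    ‖Complex.cosh t * Complex.exp (-(w * Complex.cosh t) + ν * t)‖ ≤
      1 * (Real.exp ((|ν| + 1) * |t|) * Real.exp (-w.re * Real.cosh t)) := by
  rw [norm_mul, norm_cosh_ofReal, one_mul, add_mul, Real.exp_add, one_mul,
    mul_comm (Real.exp (|ν| * |t|)), mul_assoc]
  exact mul_le_mul (cosh_le_exp_abs t) (norm_besselK_integrand_le ν w t) (norm_nonneg _)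
    (Real.exp_pos _).le

section
variable {w : ℂ}

lemma integrable_besselK_integrand (ν : ℝ) (hw : 0 < w.re) :
    Integrable fun t : ℝ => Complex.exp (-(w * Complex.cosh t) + ν * t) :=
  integrable_of_norm_le_exp_neg_cosh hw |ν| 1 (by fun_prop)
    fun t => by simpa using norm_besselK_integrand_le ν w t

lemma integrable_besselKDeriv_integrand (ν : ℝ) (hw : 0 < w.re) :
    Integrable fun t : ℝ => Complex.cosh t * Complex.exp (-(w * Complex.cosh t) + ν * t) :=
  integrable_of_norm_le_exp_neg_cosh hw (|ν| + 1) 1 (by fun_prop)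
    (norm_besselKDeriv_integrand_le ν w)

lemma hasDerivAt_besselK (ν : ℝ) (hw : 0 < w.re) :
    HasDerivAt (besselK ν) (-besselKDeriv ν w) w := by
  rw [besselKDeriv, ← MeasureTheory.integral_neg]
  have hg : Integrable fun t : ℝ =>
      Real.exp ((|ν| + 1) * |t|) * Real.exp (-(w.re / 2) * Real.cosh t) :=
    integrable_of_norm_le_exp_neg_cosh (half_pos hw) (|ν| + 1) 1 (by fun_prop) fun t => by
      rw [Real.norm_of_nonneg (by positivity), one_mul]
  refine (_root_.hasDerivAt_integral_of_dominated_loc_of_deriv_le (𝕜 := ℂ)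
    (s := {z : ℂ | w.re / 2 < z.re}) (μ := volume)
    (F := fun (z : ℂ) (t : ℝ) => Complex.exp (-(z * Complex.cosh t) + ν * t))
    (F' := fun (z : ℂ) (t : ℝ) =>
      -(Complex.cosh t * Complex.exp (-(z * Complex.cosh t) + ν * t)))
    (bound := fun t => Real.exp ((|ν| + 1) * |t|) * Real.exp (-(w.re / 2) * Real.cosh t))
    ?_ (Eventually.of_forall fun y => ?_) (integrable_besselK_integrand ν hw) ?_ ?_ hg ?_).2
  · exact (isOpen_lt continuous_const Complex.continuous_re).mem_nhds (half_lt_self hw)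
  · exact Continuous.aestronglyMeasurable (by fun_prop)
  · exact Continuous.aestronglyMeasurable (by fun_prop)
  · refine Eventually.of_forall fun t z hz => ?_
    rw [norm_neg]
    refine (norm_besselKDeriv_integrand_le ν z t).trans ?_
    rw [one_mul]
    have : w.re / 2 ≤ z.re := le_of_lt hz
    have := Real.cosh_pos t
    gcongr
  · refine Eventually.of_forall fun t z _ => ?_
    have h := ((((hasDerivAt_id z).mul_const (Complex.cosh t)).neg).add_const
      (ν * t : ℂ)).cexp
    exact h.congr_deriv (by simp; ring)

lemma differentiableOn_besselKDeriv (ν : ℝ) :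
    DifferentiableOn ℂ (besselKDeriv ν) {w | 0 < w.re} := by
  have ho : IsOpen {w : ℂ | 0 < w.re} := isOpen_lt continuous_const Complex.continuous_re
  have h : DifferentiableOn ℂ (besselK ν) {w | 0 < w.re} := fun w hw =>
    (hasDerivAt_besselK ν hw).differentiableAt.differentiableWithinAt
  refine (h.deriv ho).neg.congr fun w hw => ?_
  simp [(hasDerivAt_besselK ν hw).deriv]

lemma norm_eq_nicholsonArg (hw : 0 < w.re) (a : ℝ) :
    ‖(⟨2 * w.re * Real.cosh a, 2 * w.im * Real.sinh a⟩ : ℂ)‖ =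
      nicholsonArg ‖w‖ (w.re / ‖w‖) a := by
  have hw0 : 0 < ‖w‖ := norm_pos_iff.2 fun h => by simp [h] at hw
  refine (sq_eq_sq₀ (norm_nonneg _) (nicholsonArg_pos hw0 (by positivity) a).le).1 ?_
  rw [nicholsonArg, mul_pow, Real.sq_sqrt (by positivity), Complex.sq_norm, Complex.normSq_apply]
  have h := Complex.sq_norm w
  rw [Complex.normSq_apply] at h
  field_simp
  rw [h]
  linear_combination w.re ^ 2 * Real.cosh_sq a

lemma besselK_integrand_mul (ν : ℝ) (w : ℂ) (a b : ℝ) :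
    Complex.exp (-(w * Complex.cosh (a + b : ℝ)) + ν * (a + b : ℝ)) *
      Complex.exp (-(starRingEnd ℂ w * Complex.cosh (a - b : ℝ)) + ν * (a - b : ℝ)) =
    (Real.exp (2 * ν * a) : ℂ) * Complex.exp (-((2 * w.re * Real.cosh a : ℝ) * Complex.cosh b +
      (2 * w.im * Real.sinh a : ℝ) * Complex.I * Complex.sinh b)) := by
  rw [← Complex.exp_add, Complex.ofReal_exp, ← Complex.exp_add]
  congr 1
  push_cast
  rw [Complex.cosh_add, Complex.cosh_sub]
  have h1 := Complex.re_add_im w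
  have h2 : starRingEnd ℂ w = w.re - w.im * Complex.I := by
    apply Complex.ext <;> simp
  rw [h2]
  nth_rw 1 [← h1]
  ring

lemma norm_pos_of_re_pos (hw : 0 < w.re) : 0 < ‖w‖ := norm_pos_iff.2 fun h => by simp [h] at hw

lemma re_div_norm_le_one (w : ℂ) : w.re / ‖w‖ ≤ 1 :=
  div_le_one_of_le₀ (Complex.re_le_norm w) (norm_nonneg w)

lemma besselK_mul_besselK_conj (ν : ℝ) (hw : 0 < w.re) :
    besselK ν w * besselK ν (starRingEnd ℂ w) = (8 * nicholsonP ν ‖w‖ (w.re / ‖w‖) : ℝ) := by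
  have hw0 := norm_pos_of_re_pos hw
  have hc := div_pos hw hw0
  have hw' : 0 < (starRingEnd ℂ w).re := by simpa using hw
  rw [besselK, besselK, integral_mul_integral_eq (integrable_besselK_integrand ν hw)
    (integrable_besselK_integrand ν hw')]
  have h1 : ∀ a : ℝ, ∫ b : ℝ, Complex.exp (-(w * Complex.cosh (a + b : ℝ)) + ν * (a + b : ℝ)) *
      Complex.exp (-(starRingEnd ℂ w * Complex.cosh (a - b : ℝ)) + ν * (a - b : ℝ)) =
      ((2 * (K0 (nicholsonArg ‖w‖ (w.re / ‖w‖) a) * Real.exp (2 * ν * a)) : ℝ) : ℂ) := by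
    intro a
    simp only [besselK_integrand_mul]
    rw [MeasureTheory.integral_const_mul]
    have := integral_exp_neg_re_cosh_im_sinh
      (u := ⟨2 * w.re * Real.cosh a, 2 * w.im * Real.sinh a⟩)
      (mul_pos (mul_pos two_pos hw) (Real.cosh_pos a))
    rw [norm_eq_nicholsonArg hw] at this
    rw [this]
    push_cast
    ring
  simp only [h1]
  rw [integral_complex_ofReal, MeasureTheory.integral_const_mul, integral_even_mul_exp
    (fun a => by rw [nicholsonArg_neg])
    (integrable_K0_nicholsonArg hw0 hc (re_div_norm_le_one w) (by fun_prop) (abs_exp_mul_le ν)),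
    nicholsonP]
  push_cast
  ring

lemma mul_besselKDeriv_mul_besselK_conj (ν : ℝ) (hw : 0 < w.re) :
    w * besselKDeriv ν w * besselK ν (starRingEnd ℂ w) =
      (4 * nicholsonQ ν ‖w‖ (w.re / ‖w‖) : ℝ) +
        (16 * w.re * w.im * nicholsonS ν ‖w‖ (w.re / ‖w‖) : ℝ) * Complex.I := by
  have hw0 := norm_pos_of_re_pos hw
  have hc := div_pos hw hw0
  have hw' : 0 < (starRingEnd ℂ w).re := by simpa using hw
  set c := w.re / ‖w‖ with hcdef
  rw [besselKDeriv, besselK, mul_assoc,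
    integral_mul_integral_eq (integrable_besselKDeriv_integrand ν hw)
    (integrable_besselK_integrand ν hw'), mul_left_comm, ← MeasureTheory.integral_const_mul]
  have h1 : ∀ a : ℝ, w * ∫ b : ℝ, Complex.cosh (a + b : ℝ) *
      Complex.exp (-(w * Complex.cosh (a + b : ℝ)) + ν * (a + b : ℝ)) *
      Complex.exp (-(starRingEnd ℂ w * Complex.cosh (a - b : ℝ)) + ν * (a - b : ℝ)) =
      ((nicholsonArg ‖w‖ c a * K1 (nicholsonArg ‖w‖ c a) * Real.exp (2 * ν * a) : ℝ) : ℂ) +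
      ((4 * w.re * w.im * (K1 (nicholsonArg ‖w‖ c a) / nicholsonArg ‖w‖ c a *
        Real.exp (2 * ν * a)) : ℝ) : ℂ) * Complex.I := by
    intro a
    have hR := nicholsonArg_pos hw0 hc a
    simp only [mul_assoc (Complex.cosh _), besselK_integrand_mul]
    have h := integral_cosh_add_mul_exp
      (u := ⟨2 * w.re * Real.cosh a, 2 * w.im * Real.sinh a⟩)
      (mul_pos (mul_pos two_pos hw) (Real.cosh_pos a)) a
    have hsq : nicholsonArg ‖w‖ c a ^ 2 =
        (2 * w.re * Real.cosh a) ^ 2 + (2 * w.im * Real.sinh a) ^ 2 := by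
      rw [← norm_eq_nicholsonArg hw, Complex.sq_norm, Complex.normSq_apply]
      ring
    rw [norm_eq_nicholsonArg hw] at h
    simp only [mul_left_comm (Complex.cosh _), Complex.ofReal_add]
    rw [MeasureTheory.integral_const_mul]
    generalize hJ : (∫ b : ℝ, Complex.cosh (a + b) *
      Complex.exp (-((2 * w.re * Real.cosh a : ℝ) * Complex.cosh b +
      (2 * w.im * Real.sinh a : ℝ) * Complex.I * Complex.sinh b))) = J at h ⊢
    have hR' : (nicholsonArg ‖w‖ c a : ℂ) ≠ 0 := by exact_mod_cast hR.ne'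
    have hJ2 : J = ((2 * w.re * Real.cosh a : ℝ) * Complex.cosh a -
        (2 * w.im * Real.sinh a : ℝ) * Complex.I * Complex.sinh a) *
        (2 * K1 (nicholsonArg ‖w‖ c a) : ℝ) / nicholsonArg ‖w‖ c a := by
      rw [eq_div_iff hR', mul_comm]
      exact h
    rw [hJ2]
    have hsq' : (nicholsonArg ‖w‖ c a : ℂ) ^ 2 =
        (2 * w.re * Complex.cosh a) ^ 2 + (2 * w.im * Complex.sinh a) ^ 2 := by
      exact_mod_cast congrArg (fun x : ℝ => (x : ℂ)) hsq
    have h1 := Complex.re_add_im w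
    have h2 := Complex.cosh_sq (a : ℂ)
    nth_rw 1 [← h1]
    push_cast
    field_simp
    rw [hsq']
    ring_nf
    simp only [Complex.I_sq, h2]
    ring
  simp only [h1]
  have i1 := integrable_mul_K1_nicholsonArg hw0 hc (re_div_norm_le_one w)
    (F := fun a => Real.exp (2 * ν * a)) (by fun_prop) (abs_exp_mul_le ν)
  have i2 := integrable_K1_div_nicholsonArg hw0 hc (re_div_norm_le_one w)
    (F := fun a => Real.exp (2 * ν * a)) (by fun_prop) (abs_exp_mul_le ν)
  rw [integral_add i1.ofReal ((i2.const_mul _).ofReal.mul_const _),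
    MeasureTheory.integral_mul_const, integral_complex_ofReal, integral_complex_ofReal,
    MeasureTheory.integral_const_mul,
    integral_even_mul_exp (fun a => by rw [nicholsonArg_neg]) i1,
    integral_even_mul_exp (fun a => by rw [nicholsonArg_neg]) i2, nicholsonQ, nicholsonS]
  push_cast
  ring

lemma besselK_ne_zero (ν : ℝ) (hw : 0 < w.re) : besselK ν w ≠ 0 := by
  intro h
  have h1 := besselK_mul_besselK_conj ν hw
  rw [h, zero_mul] at h1
  have hw0 := norm_pos_of_re_pos hw
  have := nicholsonP_pos (ν := ν) hw0 (div_pos hw hw0) (re_div_norm_le_one w)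
  have h2 : (8 * nicholsonP ν ‖w‖ (w.re / ‖w‖)) = 0 := by exact_mod_cast h1.symm
  linarith

lemma mul_besselKDeriv_div_besselK (ν : ℝ) (hw : 0 < w.re) :
    w * besselKDeriv ν w / besselK ν w =
      (nicholsonQ ν ‖w‖ (w.re / ‖w‖) / (2 * nicholsonP ν ‖w‖ (w.re / ‖w‖)) : ℝ) +
      (2 * w.re * w.im * nicholsonS ν ‖w‖ (w.re / ‖w‖) /
        nicholsonP ν ‖w‖ (w.re / ‖w‖) : ℝ) * Complex.I := by
  have hw0 := norm_pos_of_re_pos hw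
  have hw' : 0 < (starRingEnd ℂ w).re := by simpa using hw
  have hP := nicholsonP_pos (ν := ν) hw0 (div_pos hw hw0) (re_div_norm_le_one w)
  rw [← mul_div_mul_right _ _ (besselK_ne_zero ν hw'), besselK_mul_besselK_conj ν hw,
    mul_besselKDeriv_mul_besselK_conj ν hw]
  have hP' : (nicholsonP ν ‖w‖ (w.re / ‖w‖) : ℂ) ≠ 0 := by exact_mod_cast hP.ne'
  push_cast
  field_simp
  ring

end

/-- Real part of `-w K_ν'(w) / K_ν(w)`, with `w = r e^{iθ}` and `c = cos θ`. -/
noncomputable def logDerivRe (ν r c : ℝ) : ℝ := nicholsonQ ν r c / (2 * nicholsonP ν r c)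

/-- Imaginary part of `-w K_ν'(w) / K_ν(w)`, with `w = r e^{iθ}`. -/
noncomputable def logDerivIm (ν r θ : ℝ) : ℝ :=
  2 * (r * Real.cos θ) * (r * Real.sin θ) * nicholsonS ν r (Real.cos θ) /
    nicholsonP ν r (Real.cos θ)

/-- The function `-w K_ν'(w) / K_ν(w)` in the logarithmic coordinate `w = exp s`. -/
noncomputable def besselLogDeriv (ν : ℝ) (s : ℂ) : ℂ :=
  Complex.exp s * besselKDeriv ν (Complex.exp s) / besselK ν (Complex.exp s)

lemma cos_pos_of_abs_lt {θ : ℝ} (hθ : |θ| < π / 2) : 0 < Real.cos θ :=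
  Real.cos_pos_of_mem_Ioo (abs_lt.1 hθ |>.imp (by simpa using ·) id)

lemma exp_re_pos {s : ℂ} (hs : |s.im| < π / 2) : 0 < (Complex.exp s).re := by
  rw [Complex.exp_re]
  exact mul_pos (Real.exp_pos _) (cos_pos_of_abs_lt hs)

lemma besselLogDeriv_apply (ν : ℝ) {s : ℂ} (hs : |s.im| < π / 2) :
    besselLogDeriv ν s = (logDerivRe ν (Real.exp s.re) (Real.cos s.im) : ℝ) +
      (logDerivIm ν (Real.exp s.re) s.im : ℝ) * Complex.I := by
  have h := mul_besselKDeriv_div_besselK ν (exp_re_pos hs)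
  rw [Complex.norm_exp, Complex.exp_re, Complex.exp_im,
    mul_div_cancel_left₀ _ (Real.exp_pos _).ne'] at h
  exact h

lemma besselLogDeriv_re (ν ρ : ℝ) {θ : ℝ} (hθ : |θ| < π / 2) :
    (besselLogDeriv ν (ρ + θ * Complex.I)).re = logDerivRe ν (Real.exp ρ) (Real.cos θ) := by
  rw [besselLogDeriv_apply ν (by simpa using hθ)]
  simp

lemma besselLogDeriv_im (ν ρ : ℝ) {θ : ℝ} (hθ : |θ| < π / 2) :
    (besselLogDeriv ν (ρ + θ * Complex.I)).im = logDerivIm ν (Real.exp ρ) θ := by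
  rw [besselLogDeriv_apply ν (by simpa using hθ)]
  simp

lemma differentiableOn_besselLogDeriv (ν : ℝ) :
    DifferentiableOn ℂ (besselLogDeriv ν) {s | |s.im| < π / 2} := by
  intro s hs
  have h1 := exp_re_pos hs
  have ho : IsOpen {w : ℂ | 0 < w.re} := isOpen_lt continuous_const Complex.continuous_re
  have hD : DifferentiableAt ℂ (besselKDeriv ν) (Complex.exp s) :=
    (differentiableOn_besselKDeriv ν).differentiableAt (ho.mem_nhds h1)
  have hK : DifferentiableAt ℂ (besselK ν) (Complex.exp s) :=
    (hasDerivAt_besselK ν h1).differentiableAt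
  have he : DifferentiableAt ℂ Complex.exp s := Complex.differentiableAt_exp
  exact ((he.mul (hD.comp s he)).div (hK.comp s he)
    (besselK_ne_zero ν h1)).differentiableWithinAt

lemma continuousOn_logDerivRe (ν ρ : ℝ) :
    ContinuousOn (fun θ => logDerivRe ν (Real.exp ρ) (Real.cos θ)) {θ | |θ| < π / 2} := by
  have h : ContinuousOn (fun θ : ℝ => (besselLogDeriv ν (ρ + θ * Complex.I)).re)
      {θ | |θ| < π / 2} :=
    Complex.continuous_re.comp_continuousOn
      ((differentiableOn_besselLogDeriv ν).continuousOn.comp (by fun_prop)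
        fun θ hθ => by simpa using hθ)
  exact h.congr fun θ hθ => (besselLogDeriv_re ν ρ hθ).symm

lemma continuous_logDerivIm (ν : ℝ) {θ : ℝ} (hθ : |θ| < π / 2) :
    Continuous fun ρ => logDerivIm ν (Real.exp ρ) θ := by
  have h : Continuous fun ρ : ℝ => (besselLogDeriv ν (ρ + θ * Complex.I)).im :=
    Complex.continuous_im.comp
      ((differentiableOn_besselLogDeriv ν).continuousOn.comp_continuous (by fun_prop)
        fun ρ => by simpa using hθ)
  simpa only [besselLogDeriv_im ν _ hθ] using h

lemma integral_logDerivIm (ν ρ₀ ρ₁ : ℝ) {φ : ℝ} (hφ₀ : 0 ≤ φ) (hφ : φ < π / 2) :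
    ∫ ρ in ρ₀..ρ₁, logDerivIm ν (Real.exp ρ) φ =
      (∫ θ in (0:ℝ)..φ, logDerivRe ν (Real.exp ρ₁) (Real.cos θ)) -
        ∫ θ in (0:ℝ)..φ, logDerivRe ν (Real.exp ρ₀) (Real.cos θ) := by
  have hφ' : |φ| < π / 2 := by rwa [abs_of_nonneg hφ₀]
  have h0 : |(0:ℝ)| < π / 2 := by simpa using half_pos Real.pi_pos
  have hd := differentiableOn_besselLogDeriv ν
  have h := Complex.integral_boundary_rect_eq_zero_of_differentiableOn (besselLogDeriv ν) ρ₀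
    ⟨ρ₁, φ⟩ (hd.mono ?_)
  · have hx : ∀ y : ℝ, |y| < π / 2 → ∀ a b : ℝ, (∫ ρ in a..b,
        besselLogDeriv ν (ρ + y * Complex.I)).im = ∫ ρ in a..b, logDerivIm ν (Real.exp ρ) y := by
      intro y hy a b
      have hc : Continuous fun ρ : ℝ => besselLogDeriv ν (ρ + y * Complex.I) :=
        hd.continuousOn.comp_continuous (by fun_prop) fun ρ => by simpa using hy
      have := Complex.imCLM.intervalIntegral_comp_comm (μ := volume) (hc.intervalIntegrable a b)
      simp only [Complex.imCLM_apply, besselLogDeriv_im ν _ hy] at this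
      exact this.symm
    have hmem : ∀ θ ∈ uIcc 0 φ, |θ| < π / 2 := by
      intro θ hθ
      rw [uIcc_of_le hφ₀] at hθ
      rw [abs_of_nonneg hθ.1]
      exact hθ.2.trans_lt hφ
    have hy : ∀ ρ : ℝ, (∫ θ in (0:ℝ)..φ, besselLogDeriv ν (ρ + θ * Complex.I)).re =
        ∫ θ in (0:ℝ)..φ, logDerivRe ν (Real.exp ρ) (Real.cos θ) := by
      intro ρ
      have hc : ContinuousOn (fun θ : ℝ => besselLogDeriv ν (ρ + θ * Complex.I)) (uIcc 0 φ) :=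
        hd.continuousOn.comp (by fun_prop) fun θ hθ => by simpa using hmem θ hθ
      have := Complex.reCLM.intervalIntegral_comp_comm (μ := volume) hc.intervalIntegrable
      simp only [Complex.reCLM_apply] at this
      rw [← this]
      exact intervalIntegral.integral_congr fun θ hθ => besselLogDeriv_re ν ρ (hmem θ hθ)
    have hz : ∫ ρ in ρ₀..ρ₁, logDerivIm ν (Real.exp ρ) 0 = 0 := by
      simp [logDerivIm]
    have h2 := congrArg Complex.im h
    simp only [Complex.ofReal_re, Complex.ofReal_im, smul_eq_mul, Complex.add_im, Complex.sub_im,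
      Complex.I_mul_im, Complex.zero_im] at h2
    rw [hx φ hφ', hy, hy] at h2
    have h3 := hx 0 h0 ρ₀ ρ₁
    rw [hz] at h3
    simp only [Complex.ofReal_zero] at h2 h3
    rw [h3] at h2
    linarith
  · intro s hs
    have := (Complex.mem_reProdIm.1 hs).2
    simp only [Complex.ofReal_im] at this
    rw [uIcc_of_le hφ₀] at this
    show |s.im| < π / 2
    rw [abs_of_nonneg this.1]
    exact this.2.trans_lt hφ

/-- The square root in `nicholsonArg`. -/
noncomputable def nicholsonRoot (c a : ℝ) : ℝ := √(Real.sinh a ^ 2 + c ^ 2)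

/-- The weight `h` with `h · R' = R - 2rc`, where `R = nicholsonArg r c`. -/
noncomputable def nicholsonWeight (c a : ℝ) : ℝ :=
  Real.sinh a / Real.cosh a * (nicholsonRoot c a / (nicholsonRoot c a + c))

/-- The derivative of `nicholsonWeight`. -/
noncomputable def nicholsonWeightDeriv (c a : ℝ) : ℝ :=
  nicholsonRoot c a / ((nicholsonRoot c a + c) * Real.cosh a ^ 2) +
    c * (nicholsonRoot c a - c) / (nicholsonRoot c a * (nicholsonRoot c a + c))

section
variable {r c : ℝ}

lemma nicholsonArg_eq (r c a : ℝ) : nicholsonArg r c a = 2 * r * nicholsonRoot c a := rfl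

lemma nicholsonRoot_sq (c a : ℝ) : nicholsonRoot c a ^ 2 = Real.sinh a ^ 2 + c ^ 2 :=
  Real.sq_sqrt (by positivity)

lemma nicholsonRoot_pos (hc : 0 < c) (a : ℝ) : 0 < nicholsonRoot c a := by
  unfold nicholsonRoot; positivity

lemma le_nicholsonRoot (c a : ℝ) : c ≤ nicholsonRoot c a :=
  Real.le_sqrt_of_sq_le (by nlinarith [sq_nonneg (Real.sinh a)])

lemma continuous_nicholsonRoot : Continuous (nicholsonRoot c) := by
  unfold nicholsonRoot; fun_prop

lemma hasDerivAt_nicholsonRoot (hc : 0 < c) (a : ℝ) :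
    HasDerivAt (nicholsonRoot c) (Real.sinh a * Real.cosh a / nicholsonRoot c a) a := by
  have h := (((Real.hasDerivAt_sinh a).pow 2).add_const (c ^ 2)).sqrt
    (by simp only [Pi.pow_apply]; positivity)
  refine h.congr_deriv ?_
  have := (nicholsonRoot_pos hc a).ne'
  change _ / (2 * nicholsonRoot c a) = _
  field_simp
  simp

lemma hasDerivAt_K0_nicholsonArg (hr : 0 < r) (hc : 0 < c) (a : ℝ) :
    HasDerivAt (fun a => K0 (nicholsonArg r c a)) (-K1 (nicholsonArg r c a) *
      (2 * r * (Real.sinh a * Real.cosh a / nicholsonRoot c a))) a :=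
  (hasDerivAt_K0 (nicholsonArg_pos hr hc a)).comp a
    ((hasDerivAt_nicholsonRoot hc a).const_mul (2 * r))

lemma hasDerivAt_nicholsonWeight (hc : 0 < c) (a : ℝ) :
    HasDerivAt (nicholsonWeight c) (nicholsonWeightDeriv c a) a := by
  have hT := nicholsonRoot_pos hc a
  have hC := Real.cosh_pos a
  have h1 := hasDerivAt_nicholsonRoot hc a
  have h := ((Real.hasDerivAt_sinh a).div (Real.hasDerivAt_cosh a) hC.ne').mul
    (h1.div (h1.add_const c) (by positivity))
  refine h.congr_deriv ?_
  have hs : Real.sinh a ^ 2 = nicholsonRoot c a ^ 2 - c ^ 2 := by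
    rw [nicholsonRoot_sq]; ring
  have hC2 : Real.cosh a ^ 2 = nicholsonRoot c a ^ 2 - c ^ 2 + 1 := by
    rw [Real.cosh_sq, hs]
  simp only [nicholsonWeightDeriv, Pi.div_apply]
  generalize nicholsonRoot c a = T at *
  field_simp
  rw [hC2, hs]
  ring

lemma continuous_nicholsonWeight (hc : 0 < c) : Continuous (nicholsonWeight c) :=
  continuous_iff_continuousAt.2 fun a => (hasDerivAt_nicholsonWeight hc a).continuousAt

lemma continuous_nicholsonWeightDeriv (hc : 0 < c) : Continuous (nicholsonWeightDeriv c) := by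
  have h := continuous_nicholsonRoot (c := c)
  have h1 : ∀ a, nicholsonRoot c a + c ≠ 0 := fun a => by
    have := nicholsonRoot_pos hc a
    positivity
  have h2 : ∀ a, nicholsonRoot c a ≠ 0 := fun a => (nicholsonRoot_pos hc a).ne'
  have h3 : ∀ a, Real.cosh a ^ 2 ≠ 0 := fun a => by positivity
  unfold nicholsonWeightDeriv
  exact (h.div ((h.add continuous_const).mul (by fun_prop))
    fun a => mul_ne_zero (h1 a) (h3 a)).add
    ((continuous_const.mul (h.sub continuous_const)).div (h.mul (h.add continuous_const))
      fun a => mul_ne_zero (h2 a) (h1 a))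

lemma nicholsonWeight_nonneg (hc : 0 < c) {a : ℝ} (ha : 0 ≤ a) : 0 ≤ nicholsonWeight c a := by
  have := nicholsonRoot_pos hc a
  have := Real.sinh_nonneg_iff.2 ha
  have := Real.cosh_pos a
  unfold nicholsonWeight
  positivity

lemma abs_nicholsonWeight_le (hc : 0 < c) (a : ℝ) :
    |nicholsonWeight c a| ≤ |Real.sinh a| / Real.cosh a := by
  have h1 := nicholsonRoot_pos hc a
  have h2 := Real.cosh_pos a
  rw [nicholsonWeight, abs_mul, abs_div, abs_of_pos h2]
  refine mul_le_of_le_one_right (by positivity) ?_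
  rw [abs_of_pos (by positivity), div_le_one (by positivity)]
  linarith

lemma abs_sinh_le_cosh (a : ℝ) : |Real.sinh a| ≤ Real.cosh a := by
  refine abs_le_of_sq_le_sq ?_ (Real.cosh_pos a).le
  linarith [Real.cosh_sq a]

lemma abs_nicholsonWeight_le_one (hc : 0 < c) (a : ℝ) : |nicholsonWeight c a| ≤ 1 :=
  (abs_nicholsonWeight_le hc a).trans
    ((div_le_one (Real.cosh_pos a)).2 (abs_sinh_le_cosh a))

lemma nicholsonWeightDeriv_nonneg (hc : 0 < c) (a : ℝ) : 0 ≤ nicholsonWeightDeriv c a := by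
  have h1 := nicholsonRoot_pos hc a
  have h2 := sub_nonneg.2 (le_nicholsonRoot c a)
  unfold nicholsonWeightDeriv
  positivity

lemma nicholsonWeightDeriv_le (hc : 0 < c) (a : ℝ) : nicholsonWeightDeriv c a ≤ 2 := by
  have h1 := nicholsonRoot_pos hc a
  have h2 := le_nicholsonRoot c a
  have h3 := Real.one_le_cosh a
  have e1 : nicholsonRoot c a / ((nicholsonRoot c a + c) * Real.cosh a ^ 2) ≤ 1 := by
    rw [div_le_one (by positivity)]
    nlinarith [one_le_pow₀ h3 (n := 2)]
  have e2 : c * (nicholsonRoot c a - c) / (nicholsonRoot c a * (nicholsonRoot c a + c)) ≤ 1 := by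
    rw [div_le_one (by positivity)]
    nlinarith
  unfold nicholsonWeightDeriv
  linarith

/-- With `y = 2rc/R`, the derivative of the weight is within `4(1-y)` of `1/2`. -/
lemma abs_nicholsonWeightDeriv_sub_half_le (hc : 0 < c) (hc1 : c ≤ 1) (a : ℝ) :
    |nicholsonWeightDeriv c a - 1 / 2| ≤ 4 * (1 - c / nicholsonRoot c a) := by
  have h1 := nicholsonRoot_pos hc a
  have h2 := le_nicholsonRoot c a
  have hC2 : Real.cosh a ^ 2 = nicholsonRoot c a ^ 2 - c ^ 2 + 1 := by
    rw [nicholsonRoot_sq, Real.cosh_sq]; ring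
  unfold nicholsonWeightDeriv
  rw [hC2]
  generalize nicholsonRoot c a = T at *
  have hD : 1 ≤ T ^ 2 - c ^ 2 + 1 := by nlinarith
  obtain ⟨y, rfl⟩ : ∃ y, c = y * T := ⟨c / T, by field_simp⟩
  have hy0 : 0 < y := pos_of_mul_pos_left hc h1.le
  have hy1 : y ≤ 1 := by nlinarith
  have e1 : y * T / T = y := by field_simp
  have e2 : T / ((T + y * T) * (T ^ 2 - (y * T) ^ 2 + 1)) =
      1 / (1 + y) - (1 - 1 / (T ^ 2 - (y * T) ^ 2 + 1)) / (1 + y) := by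
    field_simp
    ring
  have e3 : y * T * (T - y * T) / (T * (T + y * T)) = y * (1 - y) / (1 + y) := by
    field_simp
  rw [e1, e2, e3]
  have f1 : 0 ≤ 1 / (1 + y) - 1 / 2 ∧ 1 / (1 + y) - 1 / 2 ≤ (1 - y) / 2 := by
    have : 1 / (1 + y) - 1 / 2 = (1 - y) / (2 * (1 + y)) := by field_simp; ring
    rw [this]
    exact ⟨div_nonneg (by linarith) (by linarith), by gcongr; linarith⟩
  have f2 : 0 ≤ y * (1 - y) / (1 + y) ∧ y * (1 - y) / (1 + y) ≤ 1 - y := by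
    have h0 : 0 ≤ 1 - y := by linarith
    refine ⟨by positivity, ?_⟩
    rw [div_le_iff₀ (by positivity)]
    nlinarith
  have f3 : 0 ≤ 1 - 1 / (T ^ 2 - (y * T) ^ 2 + 1) ∧
      1 - 1 / (T ^ 2 - (y * T) ^ 2 + 1) ≤ 2 * (1 - y) := by
    have hD0 : 0 < T ^ 2 - (y * T) ^ 2 + 1 := by linarith
    refine ⟨sub_nonneg.2 ((div_le_one hD0).2 hD), ?_⟩
    rw [sub_le_comm, le_div_iff₀ hD0]
    have h3 : (y * T) ^ 2 ≤ 1 := by nlinarith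
    have h4 : T ^ 2 - (y * T) ^ 2 = (1 - y ^ 2) * T ^ 2 := by ring
    by_cases h5 : 1 - 2 * (1 - y) ≤ 0
    · nlinarith
    · have h6 : y ^ 2 * (T ^ 2 - (y * T) ^ 2 + 1) ≤ 1 := by
        have : 0 ≤ 1 - y ^ 2 := by nlinarith
        calc _ = (1 - y ^ 2) * (y * T) ^ 2 + y ^ 2 := by ring
          _ ≤ (1 - y ^ 2) * 1 + y ^ 2 := by gcongr
          _ = 1 := by ring
      refine le_trans ?_ h6
      gcongr
      nlinarith [sq_nonneg (1 - y)]
  have f4 : 0 ≤ (1 - 1 / (T ^ 2 - (y * T) ^ 2 + 1)) / (1 + y) ∧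
      (1 - 1 / (T ^ 2 - (y * T) ^ 2 + 1)) / (1 + y) ≤ 2 * (1 - y) :=
    ⟨div_nonneg f3.1 (by positivity), (div_le_self f3.1 (by linarith)).trans f3.2⟩
  rw [abs_le]
  constructor <;> linarith [f1.1, f1.2, f2.1, f2.2, f4.1, f4.2]

end

section
variable {ν r c : ℝ}

/-- The derivative of `nicholsonWeight c a * cosh (2νa)`. -/
noncomputable def nicholsonKernel (ν c a : ℝ) : ℝ :=
  nicholsonWeightDeriv c a * Real.cosh (2 * ν * a) +
    nicholsonWeight c a * (2 * ν * Real.sinh (2 * ν * a))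

lemma continuous_nicholsonKernel (hc : 0 < c) : Continuous (nicholsonKernel ν c) := by
  have h1 := continuous_nicholsonWeight hc
  have h2 := continuous_nicholsonWeightDeriv hc
  unfold nicholsonKernel
  fun_prop

lemma abs_nicholsonKernel_le (hν : 0 ≤ ν) (hc : 0 < c) (a : ℝ) :
    |nicholsonKernel ν c a| ≤ (2 + 2 * ν) * Real.cosh (2 * ν * a) := by
  have h1 := abs_nicholsonWeight_le_one hc a
  have h2 := nicholsonWeightDeriv_le hc a
  have h3 := nicholsonWeightDeriv_nonneg hc a
  have h4 := abs_sinh_le_cosh (2 * ν * a)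
  have h5 := Real.cosh_pos (2 * ν * a)
  refine (abs_add_le _ _).trans ?_
  rw [abs_mul, abs_mul, abs_mul, abs_of_pos h5, abs_of_nonneg h3,
    abs_of_nonneg (by positivity : 0 ≤ 2 * ν), add_mul]
  refine add_le_add (by gcongr) ?_
  calc _ ≤ 1 * (2 * ν * Real.cosh (2 * ν * a)) := by gcongr
    _ = _ := one_mul _

lemma nicholsonKernel_nonneg (hν : 0 ≤ ν) (hc : 0 < c) {a : ℝ} (ha : 0 ≤ a) :
    0 ≤ nicholsonKernel ν c a := by
  have h1 := nicholsonWeight_nonneg hc ha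
  have h3 := nicholsonWeightDeriv_nonneg hc a
  have h4 : 0 ≤ Real.sinh (2 * ν * a) := Real.sinh_nonneg_iff.2 (by positivity)
  have h5 := Real.cosh_pos (2 * ν * a)
  unfold nicholsonKernel
  positivity

lemma integrable_K0_mul_nicholsonKernel (hν : 0 ≤ ν) (hr : 0 < r) (hc : 0 < c) (hc1 : c ≤ 1) :
    Integrable fun a => K0 (nicholsonArg r c a) * nicholsonKernel ν c a :=
  integrable_K0_nicholsonArg hr hc hc1 (continuous_nicholsonKernel hc) fun a =>
    (abs_nicholsonKernel_le hν hc a).trans (mul_le_mul_of_nonneg_left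
      ((le_abs_self _).trans ((abs_cosh_mul_le ν a).trans_eq (one_mul _))) (by positivity))

lemma nicholsonArg_deriv_mul_weight (hc : 0 < c) (a : ℝ) :
    2 * r * (Real.sinh a * Real.cosh a / nicholsonRoot c a) * nicholsonWeight c a =
      nicholsonArg r c a - 2 * r * c := by
  have hT := nicholsonRoot_pos hc a
  have hC := Real.cosh_pos a
  have hs : Real.sinh a ^ 2 = nicholsonRoot c a ^ 2 - c ^ 2 := by
    rw [nicholsonRoot_sq]; ring
  rw [nicholsonWeight, nicholsonArg_eq]
  field_simp
  rw [hs]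
  ring

lemma integral_sub_mul_K1 (hν : 0 ≤ ν) (hr : 0 < r) (hc : 0 < c) (hc1 : c ≤ 1) :
    ∫ a in Ioi (0:ℝ), (nicholsonArg r c a * K1 (nicholsonArg r c a) * Real.cosh (2 * ν * a) -
      2 * r * c * (K1 (nicholsonArg r c a) * Real.cosh (2 * ν * a))) =
    ∫ a in Ioi (0:ℝ), K0 (nicholsonArg r c a) * nicholsonKernel ν c a := by
  have i1 := integrable_mul_K1_nicholsonArg hr hc hc1 (by fun_prop) (abs_cosh_mul_le ν)
  have i2 := integrable_K1_nicholsonArg hr hc hc1 (by fun_prop) (abs_cosh_mul_le ν)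
  have i3 := integrable_K0_mul_nicholsonKernel hν hr hc hc1
  have i5 : Integrable fun a =>
      nicholsonArg r c a * K1 (nicholsonArg r c a) * Real.cosh (2 * ν * a) -
      2 * r * c * (K1 (nicholsonArg r c a) * Real.cosh (2 * ν * a)) := i1.sub (i2.const_mul _)
  have i4 : Integrable fun a => K0 (nicholsonArg r c a) *
      (nicholsonWeight c a * Real.cosh (2 * ν * a)) := by
    refine integrable_K0_nicholsonArg hr hc hc1 (C := 1) (κ := |2 * ν|)
      ((continuous_nicholsonWeight hc).mul (by fun_prop)) fun a => ?_
    rw [abs_mul]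
    exact (mul_le_of_le_one_left (abs_nonneg _) (abs_nicholsonWeight_le_one hc a)).trans
      (abs_cosh_mul_le ν a)
  have h := integral_Ioi_deriv_eq
    (f := fun a => K0 (nicholsonArg r c a) * (nicholsonWeight c a * Real.cosh (2 * ν * a)))
    (f' := fun a => K0 (nicholsonArg r c a) * nicholsonKernel ν c a -
      (nicholsonArg r c a * K1 (nicholsonArg r c a) * Real.cosh (2 * ν * a) -
      2 * r * c * (K1 (nicholsonArg r c a) * Real.cosh (2 * ν * a)))) (fun a _ => ?_)
    (i3.sub i5).integrableOn i4.integrableOn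
  · rw [integral_sub i3.integrableOn i5.integrableOn] at h
    have h0 : nicholsonWeight c 0 = 0 := by simp [nicholsonWeight]
    simp only [h0, zero_mul, mul_zero, neg_zero] at h
    linarith
  · have h1 : HasDerivAt (fun a => Real.cosh (2 * ν * a))
        (Real.sinh (2 * ν * a) * (2 * ν)) a := by
      simpa using ((hasDerivAt_id a).const_mul (2 * ν)).cosh
    refine ((hasDerivAt_K0_nicholsonArg hr hc a).mul
      ((hasDerivAt_nicholsonWeight hc a).mul h1)).congr_deriv ?_
    simp only [nicholsonKernel, Pi.mul_apply]
    linear_combination (-K1 (nicholsonArg r c a) * Real.cosh (2 * ν * a)) *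
      nicholsonArg_deriv_mul_weight (r := r) hc a

lemma nicholsonQ_eq (hν : 0 ≤ ν) (hr : 0 < r) (hc : 0 < c) (hc1 : c ≤ 1) :
    nicholsonQ ν r c = 2 * r * c * (∫ a in Ioi (0:ℝ),
      K1 (nicholsonArg r c a) * Real.cosh (2 * ν * a)) +
      ∫ a in Ioi (0:ℝ), K0 (nicholsonArg r c a) * nicholsonKernel ν c a := by
  rw [← integral_sub_mul_K1 hν hr hc hc1, integral_sub
    (integrable_mul_K1_nicholsonArg hr hc hc1 (by fun_prop) (abs_cosh_mul_le ν)).integrableOn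
    ((integrable_K1_nicholsonArg hr hc hc1 (by fun_prop)
      (abs_cosh_mul_le ν)).const_mul _).integrableOn, MeasureTheory.integral_const_mul, nicholsonQ]
  ring

lemma integral_K0_mul_nicholsonKernel_nonneg (hν : 0 ≤ ν) (hc : 0 < c) :
    0 ≤ ∫ a in Ioi (0:ℝ), K0 (nicholsonArg r c a) * nicholsonKernel ν c a :=
  setIntegral_nonneg measurableSet_Ioi fun _ ha =>
    mul_nonneg (K0_nonneg _) (nicholsonKernel_nonneg hν hc (mem_Ioi.1 ha).le)

lemma integral_K0_mul_nicholsonKernel_le (hν : 0 ≤ ν) (hr : 0 < r) (hc : 0 < c) (hc1 : c ≤ 1) :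
    ∫ a in Ioi (0:ℝ), K0 (nicholsonArg r c a) * nicholsonKernel ν c a ≤
      (2 + 2 * ν) * nicholsonP ν r c := by
  rw [nicholsonP, ← MeasureTheory.integral_const_mul]
  refine setIntegral_mono (integrable_K0_mul_nicholsonKernel hν hr hc hc1).integrableOn
    ((integrable_K0_nicholsonArg hr hc hc1 (by fun_prop)
      (abs_cosh_mul_le ν)).const_mul _).integrableOn fun a => ?_
  have := (le_abs_self _).trans (abs_nicholsonKernel_le hν hc a)
  have := mul_le_mul_of_nonneg_left this (K0_nonneg (nicholsonArg r c a))
  simp only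
  linarith

lemma two_mul_mul_nicholsonP_le (hν : 0 ≤ ν) (hr : 0 < r) (hc : 0 < c) (hc1 : c ≤ 1) :
    2 * r * c * nicholsonP ν r c ≤ nicholsonQ ν r c := by
  rw [nicholsonQ_eq hν hr hc hc1]
  refine le_add_of_le_of_nonneg (mul_le_mul_of_nonneg_left ?_ (by positivity))
    (integral_K0_mul_nicholsonKernel_nonneg hν hc)
  refine setIntegral_mono (integrable_K0_nicholsonArg hr hc hc1 (by fun_prop)
      (abs_cosh_mul_le ν)).integrableOn (integrable_K1_nicholsonArg hr hc hc1 (by fun_prop)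
      (abs_cosh_mul_le ν)).integrableOn fun a => ?_
  have := K0_le_K1 (nicholsonArg_pos hr hc a)
  have := Real.cosh_pos (2 * ν * a)
  simp only
  gcongr

lemma nicholsonQ_le (hν : 0 ≤ ν) (hr : 0 < r) (hc : 0 < c) (hc1 : c ≤ 1) :
    nicholsonQ ν r c ≤ (2 * r * c + (3 + 2 * ν)) * nicholsonP ν r c := by
  rw [nicholsonQ_eq hν hr hc hc1]
  have h1 := integral_K0_mul_nicholsonKernel_le hν hr hc hc1
  have h2 : 2 * r * c * (∫ a in Ioi (0:ℝ), K1 (nicholsonArg r c a) * Real.cosh (2 * ν * a)) ≤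
      (2 * r * c + 1) * nicholsonP ν r c := by
    rw [nicholsonP, ← MeasureTheory.integral_const_mul, ← MeasureTheory.integral_const_mul]
    refine setIntegral_mono ((integrable_K1_nicholsonArg hr hc hc1 (by fun_prop)
      (abs_cosh_mul_le ν)).const_mul _).integrableOn ((integrable_K0_nicholsonArg hr hc hc1
      (by fun_prop) (abs_cosh_mul_le ν)).const_mul _).integrableOn fun a => ?_
    have hR := nicholsonArg_pos hr hc a
    have e1 := mul_K1_sub_K0_le hR
    have e2 : 2 * r * c * (K1 (nicholsonArg r c a) - K0 (nicholsonArg r c a)) ≤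
        nicholsonArg r c a * (K1 (nicholsonArg r c a) - K0 (nicholsonArg r c a)) :=
      mul_le_mul_of_nonneg_right (le_nicholsonArg hr a) (sub_nonneg.2 (K0_le_K1 hR))
    have e3 : 2 * r * c * K1 (nicholsonArg r c a) ≤ (2 * r * c + 1) * K0 (nicholsonArg r c a) := by
      linarith [K0_nonneg (nicholsonArg r c a)]
    have := mul_le_mul_of_nonneg_right e3 (Real.cosh_pos (2 * ν * a)).le
    simp only
    linarith
  linarith

lemma mul_le_logDerivRe (hν : 0 ≤ ν) (hr : 0 < r) (hc : 0 < c) (hc1 : c ≤ 1) :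
    r * c ≤ logDerivRe ν r c := by
  rw [logDerivRe, le_div_iff₀ (mul_pos two_pos (nicholsonP_pos hr hc hc1))]
  linarith [two_mul_mul_nicholsonP_le hν hr hc hc1]

lemma logDerivRe_le (hν : 0 ≤ ν) (hr : 0 < r) (hc : 0 < c) (hc1 : c ≤ 1) :
    logDerivRe ν r c ≤ r * c + (2 + ν) := by
  have hP := nicholsonP_pos (ν := ν) hr hc hc1
  rw [logDerivRe, div_le_iff₀ (mul_pos two_pos hP)]
  nlinarith [nicholsonQ_le hν hr hc hc1]

lemma abs_sinh_mul_weight_le (hν : 0 ≤ ν) (hc : 0 < c) (hc1 : c ≤ 1) {ε : ℝ} (hε : 0 < ε) (a : ℝ) :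
    |nicholsonWeight c a * (2 * ν * Real.sinh (2 * ν * a))| ≤
      (2 * ν * ε + ν / ε * (1 - c / nicholsonRoot c a)) * Real.cosh (2 * ν * a) := by
  have hT := nicholsonRoot_pos hc a
  have hC := Real.cosh_pos a
  have h1 : |nicholsonWeight c a| ≤ ε + (1 - c / nicholsonRoot c a) / (2 * ε) := by
    refine (abs_nicholsonWeight_le hc a).trans ?_
    set τ := |Real.sinh a| / Real.cosh a with hτ
    have h2 : τ ^ 2 ≤ 2 * (1 - c / nicholsonRoot c a) := by
      have h3 : τ ^ 2 ≤ 1 - (c / nicholsonRoot c a) ^ 2 := by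
        have e : 1 - (c / nicholsonRoot c a) ^ 2 =
            Real.sinh a ^ 2 / nicholsonRoot c a ^ 2 := by
          field_simp
          rw [nicholsonRoot_sq]
          ring
        rw [e, hτ, div_pow, sq_abs, nicholsonRoot_sq, Real.cosh_sq]
        have : 0 < Real.sinh a ^ 2 + c ^ 2 := by positivity
        gcongr
        nlinarith
      have h4 : c / nicholsonRoot c a ≤ 1 := (div_le_one hT).2 (le_nicholsonRoot c a)
      nlinarith [sq_nonneg (1 - c / nicholsonRoot c a)]
    have h5 : τ ≤ ε + τ ^ 2 / (4 * ε) := by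
      have : ε + τ ^ 2 / (4 * ε) - τ = (τ - 2 * ε) ^ 2 / (4 * ε) := by
        field_simp
        ring
      have : 0 ≤ (τ - 2 * ε) ^ 2 / (4 * ε) := by positivity
      linarith
    have h6 : τ ^ 2 / (4 * ε) ≤ (2 * (1 - c / nicholsonRoot c a)) / (4 * ε) := by gcongr
    have h7 : (2 * (1 - c / nicholsonRoot c a)) / (4 * ε) =
        (1 - c / nicholsonRoot c a) / (2 * ε) := by
      rw [div_eq_div_iff (by positivity) (by positivity)]
      ring
    linarith
  rw [abs_mul, abs_mul, abs_of_nonneg (by positivity : 0 ≤ 2 * ν)]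
  calc _ ≤ (ε + (1 - c / nicholsonRoot c a) / (2 * ε)) * (2 * ν * Real.cosh (2 * ν * a)) := by
        have := abs_sinh_le_cosh (2 * ν * a)
        have := (abs_nonneg _).trans h1
        gcongr
    _ = _ := by
        field_simp

lemma abs_K1_sub_K0_sub_half_le (hr : 0 < r) (hc : 0 < c) (a : ℝ) :
    |2 * r * c * (K1 (nicholsonArg r c a) - K0 (nicholsonArg r c a)) -
      K0 (nicholsonArg r c a) / 2| ≤
      ((1 - c / nicholsonRoot c a) + 1 / (r * c)) * K0 (nicholsonArg r c a) := by
  have hR := nicholsonArg_pos hr hc a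
  have hT := nicholsonRoot_pos hc a
  have h1 := mul_K1_sub_K0_le hR
  have h2 := le_mul_K1_sub_K0 hR
  have h3 := K0_nonneg (nicholsonArg r c a)
  have hy : 2 * r * c = c / nicholsonRoot c a * nicholsonArg r c a := by
    rw [nicholsonArg_eq]; field_simp
  have h4 : K0 (nicholsonArg r c a) / (8 * nicholsonArg r c a) ≤
      1 / (r * c) * K0 (nicholsonArg r c a) := by
    rw [div_mul_eq_mul_div, one_mul]
    refine div_le_div_of_nonneg_left h3 (mul_pos hr hc) ?_
    linarith [le_nicholsonArg (c := c) hr a, mul_pos hr hc]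
  have hy1 : c / nicholsonRoot c a ≤ 1 := (div_le_one hT).2 (le_nicholsonRoot c a)
  have hy0 : 0 < c / nicholsonRoot c a := by positivity
  have h6 : 0 ≤ K0 (nicholsonArg r c a) / (8 * nicholsonArg r c a) := by positivity
  rw [hy, mul_assoc]
  generalize c / nicholsonRoot c a = y at *
  rw [abs_le]
  constructor <;> nlinarith

lemma integral_one_sub_mul_K0_le (hν : 0 ≤ ν) (hr : 0 < r) (hc : 0 < c) (hc1 : c ≤ 1) :
    ∫ a in Ioi (0:ℝ), (1 - c / nicholsonRoot c a) *
      (K0 (nicholsonArg r c a) * Real.cosh (2 * ν * a)) ≤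
      (1 + ν) / (r * c) * nicholsonP ν r c := by
  have i1 := integrable_mul_K1_nicholsonArg hr hc hc1 (by fun_prop) (abs_cosh_mul_le ν)
  have i2 := integrable_K1_nicholsonArg hr hc hc1 (by fun_prop) (abs_cosh_mul_le ν)
  have h1 := integral_sub_mul_K1 hν hr hc hc1
  have h2 := integral_K0_mul_nicholsonKernel_le hν hr hc hc1
  rw [← h1] at h2
  have hrc : 0 < 2 * r * c := by positivity
  have h3 : (1 + ν) / (r * c) * nicholsonP ν r c =
      (2 * r * c)⁻¹ * ((2 + 2 * ν) * nicholsonP ν r c) := by field_simp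
  rw [h3]
  refine le_trans ?_ (mul_le_mul_of_nonneg_left h2 (inv_nonneg.2 hrc.le))
  rw [← MeasureTheory.integral_const_mul]
  refine integral_mono_of_nonneg (Eventually.of_forall fun a => ?_)
    ((i1.sub (i2.const_mul _)).const_mul _).integrableOn (Eventually.of_forall fun a => ?_)
  · have hy1 : c / nicholsonRoot c a ≤ 1 :=
      (div_le_one (nicholsonRoot_pos hc a)).2 (le_nicholsonRoot c a)
    exact mul_nonneg (sub_nonneg.2 hy1) (mul_nonneg (K0_nonneg _) (Real.cosh_pos _).le)
  · have hT := nicholsonRoot_pos hc a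
    have hT1 := le_nicholsonRoot c a
    have hK := K0_le_K1 (nicholsonArg_pos hr hc a)
    have hC := Real.cosh_pos (2 * ν * a)
    have hy0 : 0 ≤ 1 - c / nicholsonRoot c a := sub_nonneg.2 ((div_le_one hT).2 hT1)
    have e : 1 - c / nicholsonRoot c a ≤ (2 * r * c)⁻¹ * (nicholsonArg r c a - 2 * r * c) := by
      have : (2 * r * c)⁻¹ * (nicholsonArg r c a - 2 * r * c) = nicholsonRoot c a / c - 1 := by
        rw [nicholsonArg_eq]; field_simp
      rw [this]
      have : nicholsonRoot c a / c - 1 - (1 - c / nicholsonRoot c a) =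
        (nicholsonRoot c a - c) ^ 2 / (c * nicholsonRoot c a) := by field_simp
      have : 0 ≤ (nicholsonRoot c a - c) ^ 2 / (c * nicholsonRoot c a) := by positivity
      linarith
    calc (1 - c / nicholsonRoot c a) * (K0 (nicholsonArg r c a) * Real.cosh (2 * ν * a))
        ≤ ((2 * r * c)⁻¹ * (nicholsonArg r c a - 2 * r * c)) *
          (K1 (nicholsonArg r c a) * Real.cosh (2 * ν * a)) := by
          have := hy0.trans e
          have := K0_nonneg (nicholsonArg r c a)
          gcongr
      _ = _ := by ring

lemma integral_sub_sub_eq (hν : 0 ≤ ν) (hr : 0 < r) (hc : 0 < c) (hc1 : c ≤ 1) :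
    nicholsonQ ν r c - 2 * r * c * nicholsonP ν r c - nicholsonP ν r c =
      ∫ a in Ioi (0:ℝ), ((2 * r * c * (K1 (nicholsonArg r c a) - K0 (nicholsonArg r c a)) -
        K0 (nicholsonArg r c a) / 2) * Real.cosh (2 * ν * a) +
        K0 (nicholsonArg r c a) * (nicholsonKernel ν c a - Real.cosh (2 * ν * a) / 2)) := by
  have i0 := (integrable_K0_nicholsonArg hr hc hc1 (by fun_prop) (abs_cosh_mul_le ν)).integrableOn
    (s := Ioi (0:ℝ))
  have i1 := (integrable_K1_nicholsonArg hr hc hc1 (by fun_prop) (abs_cosh_mul_le ν)).integrableOn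
    (s := Ioi (0:ℝ))
  have i2 := (integrable_K0_mul_nicholsonKernel hν hr hc hc1).integrableOn (s := Ioi (0:ℝ))
  have i3 : IntegrableOn (fun a => 2 * r * c * (K1 (nicholsonArg r c a) * Real.cosh (2 * ν * a)) +
      K0 (nicholsonArg r c a) * nicholsonKernel ν c a) (Ioi 0) := (i1.const_mul _).add i2
  have i4 : IntegrableOn (fun a => 2 * r * c * (K1 (nicholsonArg r c a) * Real.cosh (2 * ν * a)) +
      K0 (nicholsonArg r c a) * nicholsonKernel ν c a -
      2 * r * c * (K0 (nicholsonArg r c a) * Real.cosh (2 * ν * a))) (Ioi 0) :=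
    i3.sub (i0.const_mul _)
  rw [nicholsonQ_eq hν hr hc hc1, nicholsonP, ← MeasureTheory.integral_const_mul,
    ← MeasureTheory.integral_const_mul, ← integral_add (i1.const_mul _) i2,
    ← integral_sub i3 (i0.const_mul _), ← integral_sub i4 i0]
  refine integral_congr_ae (Eventually.of_forall fun a => ?_)
  simp only
  ring

lemma abs_logDerivRe_sub_sub_half_le (hν : 0 ≤ ν) (hr : 0 < r) (hc : 0 < c) (hc1 : c ≤ 1) {ε : ℝ}
    (hε : 0 < ε) :
    |logDerivRe ν r c - r * c - 1 / 2| ≤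
      ((5 + ν / ε) * (1 + ν) + 1) / (r * c) + ν * ε := by
  have hP := nicholsonP_pos (ν := ν) hr hc hc1
  have i0 := (integrable_K0_nicholsonArg hr hc hc1 (by fun_prop) (abs_cosh_mul_le ν)).integrableOn
    (s := Ioi (0:ℝ))
  have iy : IntegrableOn (fun a => (1 - c / nicholsonRoot c a) *
      (K0 (nicholsonArg r c a) * Real.cosh (2 * ν * a))) (Ioi 0) := by
    refine i0.mono' ?_ (Eventually.of_forall fun a => ?_)
    · refine AEStronglyMeasurable.mul ?_ i0.aestronglyMeasurable
      exact (continuous_const.sub (continuous_const.div continuous_nicholsonRoot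
        fun a => (nicholsonRoot_pos hc a).ne')).aestronglyMeasurable
    · have hT := nicholsonRoot_pos hc a
      have hy0 : 0 ≤ 1 - c / nicholsonRoot c a :=
        sub_nonneg.2 ((div_le_one hT).2 (le_nicholsonRoot c a))
      have h1 := mul_nonneg (K0_nonneg (nicholsonArg r c a)) (Real.cosh_pos (2 * ν * a)).le
      rw [Real.norm_of_nonneg (mul_nonneg hy0 h1)]
      refine mul_le_of_le_one_left h1 ?_
      have : 0 ≤ c / nicholsonRoot c a := by positivity
      linarith
  have key : |nicholsonQ ν r c - 2 * r * c * nicholsonP ν r c - nicholsonP ν r c| ≤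
      ∫ a in Ioi (0:ℝ), ((5 + ν / ε) * ((1 - c / nicholsonRoot c a) *
        (K0 (nicholsonArg r c a) * Real.cosh (2 * ν * a))) + (1 / (r * c) + 2 * ν * ε) *
        (K0 (nicholsonArg r c a) * Real.cosh (2 * ν * a))) := by
    rw [integral_sub_sub_eq hν hr hc hc1, ← Real.norm_eq_abs]
    refine norm_integral_le_of_norm_le ((iy.const_mul _).add (i0.const_mul _))
      (Eventually.of_forall fun a => ?_)
    have hC := Real.cosh_pos (2 * ν * a)
    have hK := K0_nonneg (nicholsonArg r c a)
    have e1 := mul_le_mul_of_nonneg_right (abs_K1_sub_K0_sub_half_le hr hc a) hC.le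
    have e2 : |nicholsonKernel ν c a - Real.cosh (2 * ν * a) / 2| ≤
        4 * (1 - c / nicholsonRoot c a) * Real.cosh (2 * ν * a) +
        (2 * ν * ε + ν / ε * (1 - c / nicholsonRoot c a)) * Real.cosh (2 * ν * a) := by
      have : nicholsonKernel ν c a - Real.cosh (2 * ν * a) / 2 =
        (nicholsonWeightDeriv c a - 1 / 2) * Real.cosh (2 * ν * a) +
        nicholsonWeight c a * (2 * ν * Real.sinh (2 * ν * a)) := by
        rw [nicholsonKernel]; ring
      rw [this]
      refine (abs_add_le _ _).trans (add_le_add ?_ (abs_sinh_mul_weight_le hν hc hc1 hε a))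
      rw [abs_mul, abs_of_pos hC]
      exact mul_le_mul_of_nonneg_right (abs_nicholsonWeightDeriv_sub_half_le hc hc1 a) hC.le
    have e3 := mul_le_mul_of_nonneg_left e2 hK
    refine (norm_add_le _ _).trans ?_
    rw [norm_mul, norm_mul, Real.norm_of_nonneg hC.le, Real.norm_of_nonneg hK, Real.norm_eq_abs,
      Real.norm_eq_abs]
    refine (add_le_add e1 e3).trans (le_of_eq ?_)
    ring
  rw [integral_add (iy.const_mul _) (i0.const_mul _), MeasureTheory.integral_const_mul,
    MeasureTheory.integral_const_mul] at key
  have h5 : 0 ≤ 5 + ν / ε := by positivity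
  have key2 := key.trans (add_le_add (mul_le_mul_of_nonneg_left
    (integral_one_sub_mul_K0_le hν hr hc hc1) h5) le_rfl)
  have e : logDerivRe ν r c - r * c - 1 / 2 =
      (nicholsonQ ν r c - 2 * r * c * nicholsonP ν r c - nicholsonP ν r c) /
        (2 * nicholsonP ν r c) := by
    rw [logDerivRe]; field_simp
  rw [e, abs_div, abs_of_pos (mul_pos two_pos hP), div_le_iff₀ (mul_pos two_pos hP)]
  refine key2.trans ?_
  change _ + _ * nicholsonP ν r c ≤ _
  have h6 : 0 < 1 / (r * c) := by positivity
  have h7 : 0 ≤ (5 + ν / ε) * (1 + ν) := by positivity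
  calc _ = ((5 + ν / ε) * (1 + ν) * (1 / (r * c)) + 1 / (r * c) + 2 * ν * ε) *
        nicholsonP ν r c := by
        ring
    _ ≤ (2 * ((5 + ν / ε) * (1 + ν) * (1 / (r * c)) + 1 / (r * c)) + 2 * ν * ε) *
        nicholsonP ν r c := by
        gcongr
        nlinarith [mul_nonneg h7 h6.le]
    _ = _ := by ring

end

/-- The primitive of `cosh (2νa)` vanishing at `0`. -/
noncomputable def coshPrimitive (ν a : ℝ) : ℝ := ∫ x in (0:ℝ)..a, Real.cosh (2 * ν * x)

/-- The logarithmic derivative of `nicholsonArg r c`. -/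
noncomputable def nicholsonLogSlope (c a : ℝ) : ℝ :=
  Real.sinh a * Real.cosh a / (Real.sinh a ^ 2 + c ^ 2)

section
variable {ν r c : ℝ}

lemma hasDerivAt_coshPrimitive (ν a : ℝ) :
    HasDerivAt (coshPrimitive ν) (Real.cosh (2 * ν * a)) a := by
  have h : Continuous fun x => Real.cosh (2 * ν * x) := by fun_prop
  exact intervalIntegral.integral_hasDerivAt_right (h.intervalIntegrable _ _)
    h.stronglyMeasurable.stronglyMeasurableAtFilter h.continuousAt

lemma continuous_coshPrimitive (ν : ℝ) : Continuous (coshPrimitive ν) :=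
  continuous_iff_continuousAt.2 fun a => (hasDerivAt_coshPrimitive ν a).continuousAt

lemma two_mul_mul_coshPrimitive (ν a : ℝ) :
    2 * ν * coshPrimitive ν a = Real.sinh (2 * ν * a) := by
  rw [coshPrimitive, intervalIntegral.mul_integral_comp_mul_left (f := Real.cosh), mul_zero,
    intervalIntegral.integral_eq_sub_of_hasDerivAt (fun x _ => Real.hasDerivAt_sinh x)
      (Real.continuous_cosh.intervalIntegrable _ _), Real.sinh_zero, sub_zero]

lemma le_coshPrimitive (ν : ℝ) {a : ℝ} (ha : 0 ≤ a) : a ≤ coshPrimitive ν a := by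
  have h := intervalIntegral.integral_mono_on (μ := volume) ha
    (intervalIntegrable_const (c := (1:ℝ)))
    ((by fun_prop : Continuous fun x => Real.cosh (2 * ν * x)).intervalIntegrable 0 a)
    fun x _ => Real.one_le_cosh _
  simpa [coshPrimitive] using h

lemma abs_coshPrimitive_le (ν a : ℝ) :
    |coshPrimitive ν a| ≤ Real.exp ((1 + |2 * ν|) * |a|) := by
  have h := intervalIntegral.norm_integral_le_of_norm_le_const (a := 0) (b := a)
    (f := fun x => Real.cosh (2 * ν * x)) (C := Real.exp (|2 * ν| * |a|)) fun x hx => by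
      have h1 := abs_cosh_mul_le ν x
      rw [one_mul] at h1
      refine h1.trans ?_
      have : |x| ≤ |a| := by
        rcases le_total 0 a with h | h
        · rw [uIoc_of_le h] at hx
          rw [abs_of_nonneg h, abs_of_pos hx.1]
          exact hx.2
        · rw [uIoc_of_ge h] at hx
          rw [abs_of_nonpos h, abs_of_nonpos hx.2]
          linarith [hx.1]
      gcongr
  rw [Real.norm_eq_abs, sub_zero] at h
  refine h.trans ?_
  rw [add_mul, Real.exp_add, one_mul, mul_comm]
  gcongr
  linarith [Real.add_one_le_exp |a|]

lemma continuous_nicholsonLogSlope (hc : 0 < c) : Continuous (nicholsonLogSlope c) := by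
  unfold nicholsonLogSlope
  exact Continuous.div (by fun_prop) (by fun_prop) fun a => by positivity

lemma abs_nicholsonLogSlope_le (hc : 0 < c) (a : ℝ) :
    |nicholsonLogSlope c a| ≤ 1 / c * Real.exp |a| := by
  have hD : 0 < Real.sinh a ^ 2 + c ^ 2 := by positivity
  rw [nicholsonLogSlope, abs_div, abs_of_pos hD, abs_mul, abs_of_pos (Real.cosh_pos a)]
  have h1 : |Real.sinh a| / (Real.sinh a ^ 2 + c ^ 2) ≤ 1 / c := by
    rw [div_le_div_iff₀ hD hc]
    nlinarith [sq_nonneg (|Real.sinh a| - c), sq_abs (Real.sinh a), abs_nonneg (Real.sinh a),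
      sq_nonneg (|Real.sinh a| + c)]
  calc _ = |Real.sinh a| / (Real.sinh a ^ 2 + c ^ 2) * Real.cosh a := by ring
    _ ≤ _ := by
      have := cosh_le_exp_abs a
      have := Real.cosh_pos a
      gcongr

lemma nicholsonLogSlope_nonneg {a : ℝ} (ha : 0 ≤ a) : 0 ≤ nicholsonLogSlope c a := by
  have := Real.sinh_nonneg_iff.2 ha
  have := Real.cosh_pos a
  unfold nicholsonLogSlope
  positivity

lemma abs_nicholsonLogSlope_sub_one_le (hc : 0 < c) (hc1 : c ≤ 1) {a : ℝ} (ha : 0 < a) :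
    |nicholsonLogSlope c a - 1| ≤ 2 / a ^ 2 := by
  have hs : a ≤ Real.sinh a := Real.self_le_sinh_iff.2 ha.le
  have hD : 0 < Real.sinh a ^ 2 + c ^ 2 := by positivity
  have e : nicholsonLogSlope c a - 1 =
      (Real.sinh a * Real.exp (-a) - c ^ 2) / (Real.sinh a ^ 2 + c ^ 2) := by
    rw [nicholsonLogSlope, ← Real.cosh_sub_sinh]
    field_simp
    ring
  have h1 : 0 ≤ Real.sinh a * Real.exp (-a) :=
    mul_nonneg (ha.le.trans hs) (Real.exp_pos _).le
  have h2 : Real.sinh a * Real.exp (-a) ≤ 1 := by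
    rw [Real.exp_neg, ← div_eq_mul_inv, div_le_one (Real.exp_pos a), Real.sinh_eq]
    linarith [Real.exp_pos a, Real.exp_pos (-a)]
  rw [e, abs_div, abs_of_pos hD]
  have h3 : |Real.sinh a * Real.exp (-a) - c ^ 2| ≤ 2 := by
    rw [abs_le]
    constructor <;> nlinarith
  gcongr
  nlinarith

lemma integrable_mul_K1_mul_coshPrimitive (ν : ℝ) (hr : 0 < r) (hc : 0 < c) (hc1 : c ≤ 1) :
    Integrable fun a => nicholsonArg r c a * K1 (nicholsonArg r c a) *
      (coshPrimitive ν a * nicholsonLogSlope c a) := by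
  refine integrable_mul_K1_nicholsonArg hr hc hc1 (C := 1 / c) (κ := 2 + |2 * ν|)
    ((continuous_coshPrimitive ν).mul (continuous_nicholsonLogSlope hc)) fun a => ?_
  rw [abs_mul]
  calc _ ≤ Real.exp ((1 + |2 * ν|) * |a|) * (1 / c * Real.exp |a|) :=
        mul_le_mul (abs_coshPrimitive_le ν a) (abs_nicholsonLogSlope_le hc a) (abs_nonneg _)
          (Real.exp_pos _).le
    _ = _ := by
        rw [mul_left_comm, ← Real.exp_add]
        ring_nf

lemma nicholsonP_eq (ν : ℝ) (hr : 0 < r) (hc : 0 < c) (hc1 : c ≤ 1) :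
    nicholsonP ν r c = ∫ a in Ioi (0:ℝ), nicholsonArg r c a * K1 (nicholsonArg r c a) *
      (coshPrimitive ν a * nicholsonLogSlope c a) := by
  have i0 := integrable_K0_nicholsonArg hr hc hc1 (by fun_prop) (abs_cosh_mul_le ν)
  have i1 := integrable_mul_K1_mul_coshPrimitive ν hr hc hc1
  have i2 : Integrable fun a => K0 (nicholsonArg r c a) * coshPrimitive ν a :=
    integrable_K0_nicholsonArg hr hc hc1 (C := 1) (continuous_coshPrimitive ν)
      fun a => by simpa using abs_coshPrimitive_le ν a
  have h := integral_Ioi_deriv_eq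
    (f := fun a => K0 (nicholsonArg r c a) * coshPrimitive ν a)
    (f' := fun a => K0 (nicholsonArg r c a) * Real.cosh (2 * ν * a) -
      nicholsonArg r c a * K1 (nicholsonArg r c a) *
      (coshPrimitive ν a * nicholsonLogSlope c a)) (fun a _ => ?_)
    (i0.sub i1).integrableOn i2.integrableOn
  · rw [integral_sub i0.integrableOn i1.integrableOn] at h
    have h0 : coshPrimitive ν 0 = 0 := by simp [coshPrimitive]
    simp only [h0, mul_zero, neg_zero] at h
    rw [nicholsonP]
    linarith
  · refine ((hasDerivAt_K0_nicholsonArg hr hc a).mul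
      (hasDerivAt_coshPrimitive ν a)).congr_deriv ?_
    have hT := nicholsonRoot_pos hc a
    rw [nicholsonLogSlope, ← nicholsonRoot_sq, nicholsonArg_eq]
    field_simp
    ring

lemma exists_abs_cosh_sub_le (hν : 0 ≤ ν) (hc : 0 < c) (hc1 : c ≤ 1) {η : ℝ} (hη : 0 < η) :
    ∃ A M : ℝ, 0 ≤ A ∧ 0 ≤ M ∧ ∀ a, 0 < a →
      |Real.cosh (2 * ν * a) - 2 * ν * (coshPrimitive ν a * nicholsonLogSlope c a)| ≤
        (Ioc 0 A).indicator (fun _ => M) a +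
          η * (coshPrimitive ν a * nicholsonLogSlope c a) := by
  set A := max 2 (2 * (1 + 2 * ν) / η) with hA
  have hA2 : 2 ≤ A := le_max_left _ _
  obtain ⟨M, hM⟩ := (isCompact_Icc (a := (0:ℝ)) (b := A)).exists_bound_of_continuousOn
    (f := fun a => Real.cosh (2 * ν * a) -
      2 * ν * (coshPrimitive ν a * nicholsonLogSlope c a))
    (((by fun_prop : Continuous fun a => Real.cosh (2 * ν * a)).sub
      (continuous_const.mul ((continuous_coshPrimitive ν).mul
        (continuous_nicholsonLogSlope hc)))).continuousOn)
  have hM0 : 0 ≤ M := (norm_nonneg _).trans (hM 0 ⟨le_rfl, by linarith⟩)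
  refine ⟨A, M, by linarith, hM0, fun a ha => ?_⟩
  have hσ := le_coshPrimitive ν ha.le
  have hσ0 : 0 < coshPrimitive ν a := ha.trans_le hσ
  have hψ := nicholsonLogSlope_nonneg (c := c) ha.le
  by_cases haA : a ≤ A
  · rw [indicator_of_mem (by exact ⟨ha, haA⟩)]
    exact (hM a ⟨ha.le, haA⟩).trans (le_add_of_nonneg_right (by positivity))
  · rw [indicator_of_notMem (by simp [haA]), zero_add]
    have ha2 : 2 ≤ a := by linarith
    have h1 : |nicholsonLogSlope c a - 1| ≤ 1 / a := by
      refine (abs_nicholsonLogSlope_sub_one_le hc hc1 ha).trans ?_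
      rw [div_le_div_iff₀ (by positivity) ha]
      nlinarith
    have h2 : 1 / a ≤ 1 / 2 := by gcongr
    have h3 : 1 / 2 ≤ nicholsonLogSlope c a := by linarith [(abs_le.1 (h1.trans h2)).1]
    have h4 : 2 * (1 + 2 * ν) / η ≤ a := (le_max_right _ _).trans (not_le.1 haA).le
    have e : Real.cosh (2 * ν * a) - 2 * ν * (coshPrimitive ν a * nicholsonLogSlope c a) =
        Real.exp (-(2 * ν * a)) +
          2 * ν * coshPrimitive ν a * -(nicholsonLogSlope c a - 1) := by
      rw [← Real.cosh_sub_sinh, ← two_mul_mul_coshPrimitive]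
      ring
    have h5 : Real.exp (-(2 * ν * a)) ≤ 1 := Real.exp_le_one_iff.2 (by
      have : 0 ≤ 2 * ν * a := by positivity
      linarith)
    have h6 : 1 ≤ coshPrimitive ν a / a := (one_le_div ha).2 hσ
    rw [e]
    calc _ ≤ |Real.exp (-(2 * ν * a))| +
          |2 * ν * coshPrimitive ν a * -(nicholsonLogSlope c a - 1)| := abs_add_le _ _
      _ ≤ coshPrimitive ν a / a + 2 * ν * coshPrimitive ν a * (1 / a) := by
          rw [abs_of_pos (Real.exp_pos _), abs_mul, abs_neg,
            abs_of_nonneg (by positivity : 0 ≤ 2 * ν * coshPrimitive ν a)]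
          gcongr
          exact h5.trans h6
      _ = (1 + 2 * ν) / a * coshPrimitive ν a := by ring
      _ ≤ η / 2 * coshPrimitive ν a := by
          refine mul_le_mul_of_nonneg_right ?_ hσ0.le
          rw [div_le_div_iff₀ ha two_pos]
          rw [div_le_iff₀ hη] at h4
          linarith
      _ = η * (coshPrimitive ν a * (1 / 2)) := by ring
      _ ≤ _ := by gcongr

lemma exists_abs_nicholsonQ_sub_le (hν : 0 ≤ ν) (hc : 0 < c) (hc1 : c ≤ 1) {η : ℝ} (hη : 0 < η) :
    ∃ D : ℝ, ∀ r, 0 < r →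
      |nicholsonQ ν r c - 2 * ν * nicholsonP ν r c| ≤ D + η * nicholsonP ν r c := by
  obtain ⟨A, M, hA, hM, h⟩ := exists_abs_cosh_sub_le hν hc hc1 hη
  refine ⟨A * M, fun r hr => ?_⟩
  have i1 := integrable_mul_K1_nicholsonArg hr hc hc1 (by fun_prop) (abs_cosh_mul_le ν)
  have i2 := integrable_mul_K1_mul_coshPrimitive ν hr hc hc1
  have i3 : Integrable ((Ioc 0 A).indicator fun _ => M) := by
    rw [integrable_indicator_iff measurableSet_Ioc]
    exact integrableOn_const (by simp)
  have hI : ∫ a in Ioi (0:ℝ), (Ioc 0 A).indicator (fun _ => M) a = A * M := by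
    rw [setIntegral_indicator measurableSet_Ioc, inter_eq_right.2 Ioc_subset_Ioi_self]
    simp [hA]
  have e : nicholsonQ ν r c - 2 * ν * nicholsonP ν r c = ∫ a in Ioi (0:ℝ),
      (nicholsonArg r c a * K1 (nicholsonArg r c a) * Real.cosh (2 * ν * a) -
      2 * ν * (nicholsonArg r c a * K1 (nicholsonArg r c a) *
      (coshPrimitive ν a * nicholsonLogSlope c a))) := by
    rw [integral_sub i1.integrableOn (i2.const_mul _).integrableOn,
      MeasureTheory.integral_const_mul, ← nicholsonP_eq ν hr hc hc1, nicholsonQ]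
  have e2 : A * M + η * nicholsonP ν r c = ∫ a in Ioi (0:ℝ), ((Ioc 0 A).indicator (fun _ => M) a +
      η * (nicholsonArg r c a * K1 (nicholsonArg r c a) *
      (coshPrimitive ν a * nicholsonLogSlope c a))) := by
    rw [integral_add i3.integrableOn (i2.const_mul _).integrableOn,
      MeasureTheory.integral_const_mul, ← nicholsonP_eq ν hr hc hc1, hI]
  rw [e, e2, ← Real.norm_eq_abs]
  refine norm_integral_le_of_norm_le (i3.add (i2.const_mul _)).integrableOn
    ((ae_restrict_mem measurableSet_Ioi).mono fun a ha => ?_)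
  have hR := nicholsonArg_pos hr hc a
  have h0 : 0 ≤ nicholsonArg r c a * K1 (nicholsonArg r c a) := mul_nonneg hR.le (K1_nonneg _)
  have h1 := mul_K1_le_one hR
  have hM' : 0 ≤ (Ioc 0 A).indicator (fun _ => M) a := indicator_nonneg (fun _ _ => hM) a
  calc _ = nicholsonArg r c a * K1 (nicholsonArg r c a) *
        |Real.cosh (2 * ν * a) - 2 * ν * (coshPrimitive ν a * nicholsonLogSlope c a)| := by
        rw [Real.norm_eq_abs, ← abs_of_nonneg h0, ← abs_mul, abs_of_nonneg h0]
        ring_nf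
    _ ≤ nicholsonArg r c a * K1 (nicholsonArg r c a) * ((Ioc 0 A).indicator (fun _ => M) a +
          η * (coshPrimitive ν a * nicholsonLogSlope c a)) :=
        mul_le_mul_of_nonneg_left (h a ha) h0
    _ ≤ _ := by
        rw [mul_add]
        refine add_le_add (mul_le_of_le_one_left hM' h1) (le_of_eq (by ring))

lemma K0_le_nicholsonP (ν : ℝ) (hr : 0 < r) (hc : 0 < c) (hc1 : c ≤ 1) :
    K0 (nicholsonArg r c 1) ≤ nicholsonP ν r c := by
  have i0 := integrable_K0_nicholsonArg hr hc hc1 (by fun_prop) (abs_cosh_mul_le ν)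
  have h1 : ∫ _ in Ioc (0:ℝ) 1, K0 (nicholsonArg r c 1) = K0 (nicholsonArg r c 1) := by simp
  rw [← h1]
  calc _ ≤ ∫ a in Ioc (0:ℝ) 1, K0 (nicholsonArg r c a) * Real.cosh (2 * ν * a) := by
        refine setIntegral_mono_on (by simp) i0.integrableOn measurableSet_Ioc fun a ha => ?_
        have h2 : nicholsonArg r c a ≤ nicholsonArg r c 1 := by
          have : 0 ≤ Real.sinh a := Real.sinh_nonneg_iff.2 ha.1.le
          have : Real.sinh a ≤ Real.sinh 1 := Real.sinh_le_sinh.2 ha.2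
          unfold nicholsonArg
          gcongr
        refine (K0_anti (nicholsonArg_pos hr hc a) h2).trans
          (le_mul_of_one_le_right (K0_nonneg _) (Real.one_le_cosh _))
    _ ≤ _ := by
        refine setIntegral_mono_set i0.integrableOn (Eventually.of_forall fun a => ?_)
          (Ioc_subset_Ioi_self.eventuallyLE)
        exact mul_nonneg (K0_nonneg _) (Real.cosh_pos _).le

lemma tendsto_nicholsonP_atTop (ν : ℝ) (hc : 0 < c) (hc1 : c ≤ 1) :
    Tendsto (fun r => nicholsonP ν r c) (nhdsWithin 0 (Ioi 0)) atTop := by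
  have h : Tendsto (fun r => nicholsonArg r c 1) (nhdsWithin 0 (Ioi 0))
      (nhdsWithin 0 (Ioi 0)) := by
    refine tendsto_nhdsWithin_iff.2 ⟨?_, eventually_mem_nhdsWithin.mono fun r hr =>
      nicholsonArg_pos hr hc 1⟩
    have : Continuous fun r => nicholsonArg r c 1 := by unfold nicholsonArg; fun_prop
    have h2 := this.tendsto 0
    simp only [nicholsonArg, mul_zero, zero_mul] at h2
    exact h2.mono_left nhdsWithin_le_nhds
  exact tendsto_atTop_mono' _ (eventually_mem_nhdsWithin.mono fun r hr =>
    K0_le_nicholsonP ν hr hc hc1) (tendsto_K0_nhdsGT_zero.comp h)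

lemma tendsto_logDerivRe_zero (hν : 0 ≤ ν) (hc : 0 < c) (hc1 : c ≤ 1) :
    Tendsto (fun r => logDerivRe ν r c) (nhdsWithin 0 (Ioi 0)) (nhds ν) := by
  rw [Metric.tendsto_nhds]
  intro ε hε
  obtain ⟨D, hD⟩ := exists_abs_nicholsonQ_sub_le hν hc hc1 hε
  filter_upwards [eventually_mem_nhdsWithin,
    (tendsto_nicholsonP_atTop ν hc hc1).eventually_gt_atTop (D / ε)] with r hr hP
  have hP0 := nicholsonP_pos (ν := ν) hr hc hc1
  have h := hD r hr
  rw [div_lt_iff₀ hε] at hP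
  have e : logDerivRe ν r c - ν =
      (nicholsonQ ν r c - 2 * ν * nicholsonP ν r c) / (2 * nicholsonP ν r c) := by
    rw [logDerivRe]; field_simp
  rw [Real.dist_eq, e, abs_div, abs_of_pos (mul_pos two_pos hP0),
    div_lt_iff₀ (mul_pos two_pos hP0)]
  linarith

end

section
variable {ν r c : ℝ}

lemma continuous_K1_comp {X : Type*} [TopologicalSpace X] {f : X → ℝ} (hf : Continuous f)
    (h : ∀ x, 0 < f x) : Continuous fun x => K1 (f x) :=
  continuousOn_K1.comp_continuous hf h

lemma mul_K1_mul_cosh_div_le (ν : ℝ) {r₀ : ℝ} (hr₀ : 0 < r₀) (hr : r₀ ≤ r) (hc : 0 < c) {a : ℝ}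
    (ha : 0 ≤ a) :
    nicholsonArg r c a * K1 (nicholsonArg r c a) * (Real.cosh (2 * ν * a) / Real.cosh a) ≤
      2 * Real.exp (2 * |2 * ν| ^ 2 / r₀) := by
  have hr0 := hr₀.trans_le hr
  have hR := nicholsonArg_pos hr0 hc a
  have h1 := mul_K1_le_two_mul_exp hR
  have h2 : Real.exp (-(nicholsonArg r c a / 2)) ≤ Real.exp (-r₀ * Real.sinh a) := by
    rw [Real.exp_le_exp]
    have := sinh_le_nicholsonArg (c := c) hr0 a
    have : r₀ * Real.sinh a ≤ r * Real.sinh a :=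
      mul_le_mul_of_nonneg_right hr (Real.sinh_nonneg_iff.2 ha)
    linarith
  have h3 : Real.cosh (2 * ν * a) / Real.cosh a ≤ Real.exp (|2 * ν| * a) := by
    refine (div_le_self (Real.cosh_pos _).le (Real.one_le_cosh _)).trans ?_
    have := abs_cosh_mul_le ν a
    rw [one_mul, abs_of_nonneg ha] at this
    exact (le_abs_self _).trans this
  have h4 := exp_mul_exp_neg_sinh_le hr₀ |2 * ν| ha
  have h5 : Real.exp (-(r₀ / 8) * a ^ 2) ≤ 1 := Real.exp_le_one_iff.2 (by
    have : 0 ≤ r₀ / 8 * a ^ 2 := by positivity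
    linarith)
  calc _ ≤ 2 * Real.exp (-r₀ * Real.sinh a) * Real.exp (|2 * ν| * a) := by
        refine mul_le_mul (h1.trans (by linarith)) h3
          (div_nonneg (Real.cosh_pos _).le (Real.cosh_pos _).le) (by positivity)
    _ = 2 * (Real.exp (|2 * ν| * a) * Real.exp (-r₀ * Real.sinh a)) := by ring
    _ ≤ 2 * (Real.exp (2 * |2 * ν| ^ 2 / r₀) * 1) := by
        refine mul_le_mul_of_nonneg_left (h4.trans ?_) two_pos.le
        exact mul_le_mul_of_nonneg_left h5 (Real.exp_pos _).le
    _ = _ := by ring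

/-- The factor in front of the Poisson kernel in `nicholsonS`, after rescaling. -/
noncomputable def poissonWeight (ν r c τ : ℝ) : ℝ :=
  nicholsonArg r c (Real.arsinh (c * τ)) * K1 (nicholsonArg r c (Real.arsinh (c * τ))) *
    (Real.cosh (2 * ν * Real.arsinh (c * τ)) / Real.cosh (Real.arsinh (c * τ)))

lemma poissonWeight_nonneg (hr : 0 < r) (hc : 0 < c) (τ : ℝ) : 0 ≤ poissonWeight ν r c τ :=
  mul_nonneg (mul_nonneg (nicholsonArg_pos hr hc _).le (K1_nonneg _))
    (div_nonneg (Real.cosh_pos _).le (Real.cosh_pos _).le)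

lemma image_arsinh_mul_Ioi (hc : 0 < c) :
    (fun τ => Real.arsinh (c * τ)) '' Ioi 0 = Ioi 0 := by
  ext a
  constructor
  · rintro ⟨τ, hτ, rfl⟩
    exact Real.arsinh_pos_iff.2 (mul_pos hc hτ)
  · intro ha
    refine ⟨Real.sinh a / c, div_pos (Real.sinh_pos_iff.2 ha) hc, ?_⟩
    simp [mul_div_cancel₀ _ hc.ne']

lemma four_mul_nicholsonS (hr : 0 < r) (hc : 0 < c) :
    4 * r ^ 2 * c * nicholsonS ν r c =
      ∫ τ in Ioi (0:ℝ), poissonWeight ν r c τ * (1 + τ ^ 2)⁻¹ := by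
  have hd : ∀ τ ∈ Ioi (0:ℝ), HasDerivWithinAt (fun τ => Real.arsinh (c * τ))
      ((√(1 + (c * τ) ^ 2))⁻¹ * (c * 1)) (Ioi 0) τ := fun τ _ =>
    ((Real.hasDerivAt_arsinh (c * τ)).comp τ ((hasDerivAt_id τ).const_mul c)).hasDerivWithinAt
  have hinj : InjOn (fun τ => Real.arsinh (c * τ)) (Ioi 0) := fun x _ y _ hxy =>
    mul_left_cancel₀ hc.ne' (Real.arsinh_injective hxy)
  rw [nicholsonS, ← image_arsinh_mul_Ioi hc,
    integral_image_eq_integral_abs_deriv_smul measurableSet_Ioi hd hinj,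
    ← MeasureTheory.integral_const_mul, image_arsinh_mul_Ioi hc]
  refine setIntegral_congr_fun measurableSet_Ioi fun τ _ => ?_
  have hR := nicholsonArg_pos hr hc (Real.arsinh (c * τ))
  have hs : 0 < √(1 + (c * τ) ^ 2) := by positivity
  have hR2 : nicholsonArg r c (Real.arsinh (c * τ)) ^ 2 = 4 * r ^ 2 * c ^ 2 * (1 + τ ^ 2) := by
    rw [nicholsonArg, mul_pow, Real.sq_sqrt (by positivity), Real.sinh_arsinh]
    ring
  have h1 : (1 + τ ^ 2)⁻¹ =
      4 * r ^ 2 * c ^ 2 * (nicholsonArg r c (Real.arsinh (c * τ)) ^ 2)⁻¹ := by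
    rw [hR2]
    have : 0 < 1 + τ ^ 2 := by positivity
    field_simp
  simp only [poissonWeight, smul_eq_mul]
  rw [abs_of_pos (by positivity), Real.cosh_arsinh, h1]
  field_simp

lemma poissonWeight_le (ν : ℝ) {r₀ : ℝ} (hr₀ : 0 < r₀) (hr : r₀ ≤ r) (hc : 0 < c) {τ : ℝ}
    (hτ : 0 < τ) : poissonWeight ν r c τ ≤ 2 * Real.exp (2 * |2 * ν| ^ 2 / r₀) :=
  mul_K1_mul_cosh_div_le ν hr₀ hr hc (Real.arsinh_nonneg_iff.2 (mul_pos hc hτ).le)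

lemma continuous_poissonWeight (hr : 0 < r) (hc : 0 < c) :
    Continuous (poissonWeight ν r c) := by
  have ha : Continuous fun τ => Real.arsinh (c * τ) :=
    Real.continuous_arsinh.comp (continuous_const_mul c)
  have hR : Continuous fun τ => nicholsonArg r c (Real.arsinh (c * τ)) :=
    continuous_nicholsonArg.comp ha
  refine (hR.mul (continuous_K1_comp hR fun τ => nicholsonArg_pos hr hc _)).mul ?_
  exact (Real.continuous_cosh.comp (ha.const_mul _)).div (Real.continuous_cosh.comp ha)
    fun τ => (Real.cosh_pos _).ne'

lemma integral_Ioi_zero_inv_one_add_sq : ∫ τ in Ioi (0:ℝ), (1 + τ ^ 2)⁻¹ = π / 2 := by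
  simp [integral_Ioi_inv_one_add_sq]

lemma four_mul_nicholsonS_le (ν : ℝ) {r₀ : ℝ} (hr₀ : 0 < r₀) (hr : r₀ ≤ r) (hc : 0 < c) :
    |4 * r ^ 2 * c * nicholsonS ν r c| ≤ 2 * Real.exp (2 * |2 * ν| ^ 2 / r₀) * (π / 2) := by
  rw [four_mul_nicholsonS (hr₀.trans_le hr) hc, ← integral_Ioi_zero_inv_one_add_sq,
    ← MeasureTheory.integral_const_mul, ← Real.norm_eq_abs]
  refine norm_integral_le_of_norm_le (integrable_inv_one_add_sq.const_mul _).integrableOn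
    ((ae_restrict_mem measurableSet_Ioi).mono fun τ hτ => ?_)
  rw [Real.norm_of_nonneg (mul_nonneg (poissonWeight_nonneg (hr₀.trans_le hr) hc τ)
    (by positivity))]
  exact mul_le_mul_of_nonneg_right (poissonWeight_le ν hr₀ hr hc hτ) (by positivity)

lemma tendsto_mul_K1_nhdsGT_zero :
    Tendsto (fun x => x * K1 x) (nhdsWithin 0 (Ioi 0)) (nhds 1) := by
  refine tendsto_of_tendsto_of_tendsto_of_le_of_le' (g := fun x => Real.exp (-x))
    (h := fun _ => 1) ?_ tendsto_const_nhds
    (eventually_mem_nhdsWithin.mono fun x hx => exp_neg_le_mul_K1 hx)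
    (eventually_mem_nhdsWithin.mono fun x hx => mul_K1_le_one hx)
  have : Continuous fun x : ℝ => Real.exp (-x) := by fun_prop
  simpa using (this.tendsto 0).mono_left (nhdsWithin_le_nhds (s := Ioi 0))

lemma tendsto_poissonWeight (hr : 0 < r) (τ : ℝ) :
    Tendsto (fun c => poissonWeight ν r c τ) (nhdsWithin 0 (Ioi 0)) (nhds 1) := by
  have h1 : Tendsto (fun c => nicholsonArg r c (Real.arsinh (c * τ))) (nhdsWithin 0 (Ioi 0))
      (nhdsWithin 0 (Ioi 0)) := by
    refine tendsto_nhdsWithin_iff.2 ⟨?_, eventually_mem_nhdsWithin.mono fun c hc =>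
      nicholsonArg_pos hr hc _⟩
    have : Continuous fun c => nicholsonArg r c (Real.arsinh (c * τ)) := by
      simp only [nicholsonArg, Real.sinh_arsinh]; fun_prop
    have h2 := this.tendsto 0
    simp only [nicholsonArg, zero_mul, Real.arsinh_zero, Real.sinh_zero] at h2
    refine Tendsto.mono_left ?_ (nhdsWithin_le_nhds (s := Ioi 0))
    simpa [nicholsonArg] using h2
  have h2 : Tendsto (fun c => Real.cosh (2 * ν * Real.arsinh (c * τ)) /
      Real.cosh (Real.arsinh (c * τ))) (nhdsWithin 0 (Ioi 0)) (nhds 1) := by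
    have ha : Continuous fun c => Real.arsinh (c * τ) :=
      Real.continuous_arsinh.comp (continuous_mul_const τ)
    have : Continuous fun c => Real.cosh (2 * ν * Real.arsinh (c * τ)) /
        Real.cosh (Real.arsinh (c * τ)) :=
      (Real.continuous_cosh.comp (ha.const_mul _)).div (Real.continuous_cosh.comp ha)
        fun c => (Real.cosh_pos _).ne'
    simpa using (this.tendsto 0).mono_left (nhdsWithin_le_nhds (s := Ioi 0))
  rw [← one_mul (1:ℝ)]
  exact (tendsto_mul_K1_nhdsGT_zero.comp h1).mul h2

lemma tendsto_four_mul_nicholsonS (ν : ℝ) (hr : 0 < r) :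
    Tendsto (fun c => 4 * r ^ 2 * c * nicholsonS ν r c) (nhdsWithin 0 (Ioi 0))
      (nhds (π / 2)) := by
  have h : Tendsto (fun c => ∫ τ in Ioi (0:ℝ), poissonWeight ν r c τ * (1 + τ ^ 2)⁻¹)
      (nhdsWithin 0 (Ioi 0)) (nhds (∫ τ in Ioi (0:ℝ), 1 * (1 + τ ^ 2)⁻¹)) := by
    refine tendsto_integral_filter_of_dominated_convergence
      (fun τ => 2 * Real.exp (2 * |2 * ν| ^ 2 / r) * (1 + τ ^ 2)⁻¹) ?_ ?_
      (integrable_inv_one_add_sq.const_mul _).integrableOn ?_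
    · refine eventually_mem_nhdsWithin.mono fun c hc => Continuous.aestronglyMeasurable ?_
      exact (continuous_poissonWeight hr hc).mul
        (Continuous.inv₀ (by fun_prop) fun τ => by positivity)
    · refine eventually_mem_nhdsWithin.mono fun c hc =>
        (ae_restrict_mem measurableSet_Ioi).mono fun τ hτ => ?_
      rw [Real.norm_of_nonneg (mul_nonneg (poissonWeight_nonneg hr hc τ) (by positivity))]
      exact mul_le_mul_of_nonneg_right (poissonWeight_le ν hr le_rfl hc hτ) (by positivity)
    · exact Eventually.of_forall fun τ => (tendsto_poissonWeight hr τ).mul_const _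
  simp only [one_mul, integral_Ioi_zero_inv_one_add_sq] at h
  exact h.congr' (eventually_mem_nhdsWithin.mono fun c hc => (four_mul_nicholsonS hr hc).symm)

/-- The boundary value of `nicholsonP` on the imaginary axis. -/
noncomputable def nicholsonN (ν r : ℝ) : ℝ :=
  ∫ t in Ioi (0:ℝ), K0 (2 * r * Real.sinh t) * Real.cosh (2 * ν * t)

lemma K0_add_log_le {x : ℝ} (hx : 0 < x) (hx1 : x ≤ 1) : K0 x + Real.log x ≤ K0 1 := by
  have hd : ∀ y ∈ Ioi (0:ℝ), HasDerivAt (fun x => K0 x + Real.log x) (-K1 y + y⁻¹) y :=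
    fun y hy => (hasDerivAt_K0 hy).add (Real.hasDerivAt_log (ne_of_gt hy))
  have hm : MonotoneOn (fun x => K0 x + Real.log x) (Ioi 0) := by
    refine monotoneOn_of_deriv_nonneg (convex_Ioi 0)
      (fun y hy => (hd y hy).continuousAt.continuousWithinAt)
      (fun y hy => ?_) fun y hy => ?_
    · rw [interior_Ioi] at hy
      exact (hd y hy).differentiableAt.differentiableWithinAt
    · rw [interior_Ioi] at hy
      rw [(hd y hy).deriv]
      have hy' : 0 < y := hy
      have : K1 y ≤ y⁻¹ := by
        rw [← one_div, le_div_iff₀ hy', mul_comm]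
        exact mul_K1_le_one hy
      linarith
  simpa using hm (mem_Ioi.2 hx) (mem_Ioi.2 one_pos) hx1

lemma continuousOn_K0_sinh (ν : ℝ) (hr : 0 < r) :
    ContinuousOn (fun t => K0 (2 * r * Real.sinh t) * Real.cosh (2 * ν * t)) (Ioi 0) := by
  refine ContinuousOn.mul (continuousOn_K0.comp (by fun_prop) fun t ht => ?_) (by fun_prop)
  exact mul_pos (mul_pos two_pos hr) (Real.sinh_pos_iff.2 ht)

lemma integrableOn_K0_sinh (ν : ℝ) (hr : 0 < r) :
    IntegrableOn (fun t => K0 (2 * r * Real.sinh t) * Real.cosh (2 * ν * t)) (Ioi 0) := by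
  set b : ℝ := 1 / (2 * r) with hb
  have hb0 : 0 < b := by positivity
  have hs : ∀ t, 0 ≤ t → 2 * r * t ≤ 2 * r * Real.sinh t := fun t ht =>
    mul_le_mul_of_nonneg_left (Real.self_le_sinh_iff.2 ht) (by positivity)
  rw [← Ioc_union_Ioi_eq_Ioi hb0.le]
  refine IntegrableOn.union ?_ ?_
  · have hl : IntegrableOn (fun t => (K0 1 - (Real.log (2 * r) + Real.log t)) *
        Real.cosh (2 * ν * b)) (Ioc 0 b) := by
      have : IntegrableOn Real.log (Ioc 0 b) := by
        have h := intervalIntegrable_log' (a := 0) (b := b)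
        rwa [intervalIntegrable_iff_integrableOn_Ioc_of_le hb0.le] at h
      have hc : ∀ k : ℝ, IntegrableOn (fun _ => k) (Ioc 0 b) := fun k =>
        integrableOn_const (by simp)
      exact (((hc _).sub ((hc _).add this)).mul_const _)
    refine Integrable.mono' hl (((continuousOn_K0_sinh ν hr).mono
      Ioc_subset_Ioi_self).aestronglyMeasurable measurableSet_Ioc)
      ((ae_restrict_mem measurableSet_Ioc).mono fun t ht => ?_)
    have ht0 : 0 < t := ht.1
    have h1 : 2 * r * t ≤ 1 := by
      have := ht.2
      rwa [hb, le_div_iff₀ (by positivity), mul_comm] at this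
    have h2 := K0_add_log_le (by positivity) h1
    rw [Real.log_mul (by positivity) ht0.ne'] at h2
    have h3 : K0 (2 * r * Real.sinh t) ≤ K0 (2 * r * t) := K0_anti (by positivity) (hs t ht0.le)
    rw [Real.norm_of_nonneg (mul_nonneg (K0_nonneg _) (Real.cosh_pos _).le)]
    refine mul_le_mul (by linarith) ?_ (Real.cosh_pos _).le ((K0_nonneg (2 * r * t)).trans ?_)
    · rw [Real.cosh_le_cosh, abs_mul, abs_mul _ b, abs_of_pos ht0, abs_of_pos hb0]
      exact mul_le_mul_of_nonneg_left ht.2 (abs_nonneg _)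
    · linarith
  · have hi : Integrable fun t => 2 * Real.exp r *
        (Real.exp (|2 * ν| * |t|) * Real.exp (-r * Real.cosh t)) := by
      refine integrable_of_norm_le_exp_neg_cosh hr |2 * ν| (2 * Real.exp r) (by fun_prop)
        fun t => ?_
      rw [Real.norm_of_nonneg (by positivity)]
    refine Integrable.mono' hi.integrableOn (((continuousOn_K0_sinh ν hr).mono
      (Ioi_subset_Ioi hb0.le)).aestronglyMeasurable measurableSet_Ioi)
      ((ae_restrict_mem measurableSet_Ioi).mono fun t ht => ?_)
    have ht0 : 0 < t := hb0.trans ht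
    have h1 : 1 ≤ 2 * r * t := by
      have := (mem_Ioi.1 ht).le
      rwa [hb, div_le_iff₀ (by positivity), mul_comm] at this
    have h2 := abs_K0_le one_pos (h1.trans (hs t ht0.le))
    have h3 : Real.cosh t ≤ 1 + Real.sinh t := by
      have := Real.cosh_sub_sinh t
      have : Real.exp (-t) ≤ 1 := Real.exp_le_one_iff.2 (by linarith)
      linarith
    rw [norm_mul, Real.norm_eq_abs, Real.norm_eq_abs]
    calc _ ≤ 2 / 1 * Real.exp (-(2 * r * Real.sinh t / 2)) *
          (1 * Real.exp (|2 * ν| * |t|)) :=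
          mul_le_mul h2 (abs_cosh_mul_le ν t) (abs_nonneg _) (by positivity)
      _ ≤ 2 / 1 * (Real.exp r * Real.exp (-r * Real.cosh t)) *
          (1 * Real.exp (|2 * ν| * |t|)) := by
          rw [← Real.exp_add]
          have h4 : r * Real.cosh t ≤ r * (1 + Real.sinh t) := mul_le_mul_of_nonneg_left h3 hr.le
          gcongr
          linarith
      _ = _ := by ring

lemma nicholsonN_pos (ν : ℝ) (hr : 0 < r) : 0 < nicholsonN ν r := by
  refine (setIntegral_pos_iff_support_of_nonneg_ae ?_ (integrableOn_K0_sinh ν hr)).2 ?_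
  · exact Eventually.of_forall fun a => mul_nonneg (K0_nonneg _) (Real.cosh_pos _).le
  · have : Ioi (0:ℝ) ⊆ (Function.support fun t => K0 (2 * r * Real.sinh t) *
        Real.cosh (2 * ν * t)) := fun t ht => by
      have := K0_pos (mul_pos (mul_pos two_pos hr) (Real.sinh_pos_iff.2 ht))
      simp [this.ne', (Real.cosh_pos _).ne']
    rw [inter_eq_right.2 this]
    simp

lemma nicholsonN_anti (ν : ℝ) {r' : ℝ} (hr : 0 < r) (h : r ≤ r') :
    nicholsonN ν r' ≤ nicholsonN ν r := by
  refine setIntegral_mono_on (integrableOn_K0_sinh ν (hr.trans_le h)) (integrableOn_K0_sinh ν hr)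
    measurableSet_Ioi fun t ht => ?_
  have hs := Real.sinh_pos_iff.2 ht
  refine mul_le_mul_of_nonneg_right (K0_anti (by positivity) ?_) (Real.cosh_pos _).le
  gcongr

lemma tendsto_nicholsonP (ν : ℝ) (hr : 0 < r) :
    Tendsto (fun c => nicholsonP ν r c) (nhdsWithin 0 (Ioi 0)) (nhds (nicholsonN ν r)) := by
  refine tendsto_integral_filter_of_dominated_convergence
    (fun t => K0 (2 * r * Real.sinh t) * Real.cosh (2 * ν * t)) ?_ ?_
    (integrableOn_K0_sinh ν hr) ?_
  · refine eventually_mem_nhdsWithin.mono fun c hc => Continuous.aestronglyMeasurable ?_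
    exact (continuousOn_K0.comp_continuous continuous_nicholsonArg
      fun a => nicholsonArg_pos hr hc a).mul (by fun_prop)
  · refine eventually_mem_nhdsWithin.mono fun c hc =>
      (ae_restrict_mem measurableSet_Ioi).mono fun t ht => ?_
    rw [Real.norm_of_nonneg (mul_nonneg (K0_nonneg _) (Real.cosh_pos _).le)]
    exact mul_le_mul_of_nonneg_right (K0_anti (mul_pos (mul_pos two_pos hr)
      (Real.sinh_pos_iff.2 ht)) (sinh_le_nicholsonArg hr t)) (Real.cosh_pos _).le
  · refine (ae_restrict_mem measurableSet_Ioi).mono fun t ht => Tendsto.mul_const _ ?_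
    have hs := Real.sinh_pos_iff.2 ht
    have hx : 0 < 2 * r * Real.sinh t := by positivity
    have h1 : Continuous fun c => nicholsonArg r c t := by unfold nicholsonArg; fun_prop
    have h2 := h1.tendsto 0
    have e : nicholsonArg r 0 t = 2 * r * Real.sinh t := by
      simp [nicholsonArg, Real.sqrt_sq hs.le]
    rw [e] at h2
    exact ((hasDerivAt_K0 hx).continuousAt.tendsto.comp h2).mono_left nhdsWithin_le_nhds

end

section
variable {ν r : ℝ}

lemma logDerivIm_eq (ν r θ : ℝ) :
    logDerivIm ν r θ = Real.sin θ / 2 * (4 * r ^ 2 * Real.cos θ * nicholsonS ν r (Real.cos θ)) /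
      nicholsonP ν r (Real.cos θ) := by
  rw [logDerivIm]
  ring

lemma tendsto_logDerivIm (ν : ℝ) (hr : 0 < r) :
    Tendsto (fun θ => logDerivIm ν r θ) (nhdsWithin (π / 2) (Iio (π / 2)))
      (nhds (2 / π / M2 ν r)) := by
  have hN := nicholsonN_pos ν hr
  have hs : Tendsto (fun θ => Real.sin θ / 2) (nhdsWithin (π / 2) (Iio (π / 2)))
      (nhds (1 / 2)) := by
    have : Continuous fun θ => Real.sin θ / 2 := by fun_prop
    simpa using (this.tendsto (π / 2)).mono_left (nhdsWithin_le_nhds (s := Iio (π / 2)))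
  have h := (hs.mul ((tendsto_four_mul_nicholsonS ν hr).comp Real.tendsto_cos_pi_div_two)).div
    ((tendsto_nicholsonP ν hr).comp Real.tendsto_cos_pi_div_two) hN.ne'
  have e : 2 / π / M2 ν r = 1 / 2 * (π / 2) / nicholsonN ν r := by
    have : M2 ν r = 8 / π ^ 2 * nicholsonN ν r := rfl
    rw [this]
    field_simp
    norm_num
  rw [e]
  exact h.congr fun θ => (logDerivIm_eq ν r θ).symm

lemma abs_logDerivIm_le (ν : ℝ) {r₀ r₁ θ : ℝ} (hr₀ : 0 < r₀) (h₀ : r₀ ≤ r) (h₁ : r ≤ r₁)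
    (hθ : |θ| < π / 2) :
    |logDerivIm ν r θ| ≤
      2 * Real.exp (2 * |2 * ν| ^ 2 / r₀) * (π / 2) / K0 (nicholsonArg r₁ 1 1) := by
  have hr := hr₀.trans_le h₀
  have hc := cos_pos_of_abs_lt hθ
  have hc1 := Real.cos_le_one θ
  have hK := K0_pos (nicholsonArg_pos (hr.trans_le h₁) one_pos 1)
  have hP : K0 (nicholsonArg r₁ 1 1) ≤ nicholsonP ν r (Real.cos θ) :=
    (K0_anti (nicholsonArg_pos hr hc 1)
      (nicholsonArg_mono (hr.trans_le h₁).le h₁ hc.le hc1 1)).trans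
      (K0_le_nicholsonP ν hr hc hc1)
  have hS := four_mul_nicholsonS_le ν hr₀ h₀ hc
  have hs : |Real.sin θ / 2| ≤ 1 := by
    rw [abs_div, abs_two]
    linarith [Real.abs_sin_le_one θ]
  rw [logDerivIm_eq, abs_div, abs_mul, abs_of_pos (hK.trans_le hP)]
  refine div_le_div₀ (by positivity) ?_ hK hP
  exact (mul_le_of_le_one_left (abs_nonneg _) hs).trans hS

/-- Angular integral of the real part of the logarithmic derivative over a quarter circle. -/
noncomputable def angularIntegral (ν r : ℝ) : ℝ :=
  ∫ θ in Ioo 0 (π / 2), logDerivRe ν r (Real.cos θ)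

lemma abs_lt_of_mem_Ioo {θ : ℝ} (hθ : θ ∈ Ioo 0 (π / 2)) : |θ| < π / 2 := by
  rw [abs_of_pos hθ.1]
  exact hθ.2

lemma aestronglyMeasurable_logDerivRe (ν : ℝ) (hr : 0 < r) :
    AEStronglyMeasurable (fun θ => logDerivRe ν r (Real.cos θ))
      (volume.restrict (Ioo 0 (π / 2))) := by
  have h := continuousOn_logDerivRe ν (Real.log r)
  rw [Real.exp_log hr] at h
  exact (h.mono fun θ hθ => abs_lt_of_mem_Ioo hθ).aestronglyMeasurable measurableSet_Ioo

lemma norm_logDerivRe_le (hν : 0 ≤ ν) (hr : 0 < r) {θ : ℝ} (hθ : θ ∈ Ioo 0 (π / 2)) :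
    ‖logDerivRe ν r (Real.cos θ)‖ ≤ r + (2 + ν) := by
  have hc := cos_pos_of_abs_lt (abs_lt_of_mem_Ioo hθ)
  have hc1 := Real.cos_le_one θ
  have h1 := mul_le_logDerivRe hν hr hc hc1
  have h2 := logDerivRe_le hν hr hc hc1
  have h3 : 0 ≤ r * Real.cos θ := by positivity
  rw [Real.norm_of_nonneg (h3.trans h1)]
  nlinarith

lemma integrableOn_logDerivRe (hν : 0 ≤ ν) (hr : 0 < r) :
    IntegrableOn (fun θ => logDerivRe ν r (Real.cos θ)) (Ioo 0 (π / 2)) :=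
  Integrable.mono' (integrableOn_const (C := r + (2 + ν)) (by simp))
    (aestronglyMeasurable_logDerivRe ν hr)
    ((ae_restrict_mem measurableSet_Ioo).mono fun _ hθ => norm_logDerivRe_le hν hr hθ)

lemma tendsto_integral_logDerivRe (hν : 0 ≤ ν) (hr : 0 < r) :
    Tendsto (fun φ => ∫ θ in (0:ℝ)..φ, logDerivRe ν r (Real.cos θ))
      (nhdsWithin (π / 2) (Iio (π / 2))) (nhds (angularIntegral ν r)) := by
  have hπ := half_pos Real.pi_pos
  have hi : IntegrableOn (fun θ => logDerivRe ν r (Real.cos θ)) (uIcc 0 (π / 2)) := by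
    rw [uIcc_of_le hπ.le, integrableOn_Icc_iff_integrableOn_Ioo]
    exact integrableOn_logDerivRe hν hr
  have h := continuousOn_primitive_interval hi (π / 2) right_mem_uIcc
  rw [uIcc_of_le hπ.le] at h
  have h2 := (h.mono Ico_subset_Icc_self).tendsto
  rw [nhdsWithin_Ico_eq_nhdsLT hπ, intervalIntegral.integral_of_le hπ.le,
    integral_Ioc_eq_integral_Ioo] at h2
  exact h2

lemma monotone_div_M2_exp (ν : ℝ) : Monotone fun ρ => 2 / π / M2 ν (Real.exp ρ) := by
  intro ρ ρ' h
  have h1 := nicholsonN_anti ν (Real.exp_pos ρ) (Real.exp_le_exp.2 h)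
  have h2 := nicholsonN_pos ν (Real.exp_pos ρ')
  refine div_le_div_of_nonneg_left (by positivity) (mul_pos (by positivity) h2) ?_
  exact mul_le_mul_of_nonneg_left h1 (by positivity)

lemma integral_div_M2_exp (hν : 0 ≤ ν) {ρ₀ ρ₁ : ℝ} (h : ρ₀ ≤ ρ₁) :
    ∫ ρ in ρ₀..ρ₁, 2 / π / M2 ν (Real.exp ρ) =
      angularIntegral ν (Real.exp ρ₁) - angularIntegral ν (Real.exp ρ₀) := by
  have hπ := half_pos Real.pi_pos
  have hφ : ∀ᶠ φ in nhdsWithin (π / 2) (Iio (π / 2)), φ ∈ Ioo 0 (π / 2) :=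
    Ioo_mem_nhdsLT hπ
  have h1 : Tendsto (fun φ => ∫ ρ in ρ₀..ρ₁, logDerivIm ν (Real.exp ρ) φ)
      (nhdsWithin (π / 2) (Iio (π / 2)))
      (nhds (∫ ρ in ρ₀..ρ₁, 2 / π / M2 ν (Real.exp ρ))) := by
    refine intervalIntegral.tendsto_integral_filter_of_dominated_convergence
      (fun _ => 2 * Real.exp (2 * |2 * ν| ^ 2 / Real.exp ρ₀) * (π / 2) /
        K0 (nicholsonArg (Real.exp ρ₁) 1 1)) ?_ ?_ intervalIntegrable_const ?_
    · exact hφ.mono fun φ hφ =>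
        (continuous_logDerivIm ν (abs_lt_of_mem_Ioo hφ)).aestronglyMeasurable
    · refine hφ.mono fun φ hφ => Eventually.of_forall fun ρ hρ => ?_
      rw [uIoc_of_le h] at hρ
      exact abs_logDerivIm_le ν (Real.exp_pos ρ₀) (Real.exp_le_exp.2 hρ.1.le)
        (Real.exp_le_exp.2 hρ.2) (abs_lt_of_mem_Ioo hφ)
    · exact Eventually.of_forall fun ρ _ => tendsto_logDerivIm ν (Real.exp_pos ρ)
  have h2 := (tendsto_integral_logDerivRe hν (Real.exp_pos ρ₁)).sub
    (tendsto_integral_logDerivRe hν (Real.exp_pos ρ₀))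
  refine tendsto_nhds_unique h1 (h2.congr' ?_)
  exact hφ.mono fun φ hφ => (integral_logDerivIm ν ρ₀ ρ₁ hφ.1.le hφ.2).symm

lemma tendsto_angularIntegral_zero (hν : 0 ≤ ν) :
    Tendsto (angularIntegral ν) (nhdsWithin 0 (Ioi 0)) (nhds (ν * (π / 2))) := by
  have e : ∫ _ in Ioo 0 (π / 2), ν = ν * (π / 2) := by
    have hπ := half_pos Real.pi_pos
    simp [hπ.le, mul_comm]
  rw [← e]
  refine tendsto_integral_filter_of_dominated_convergence (fun _ => 1 + (2 + ν)) ?_ ?_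
    (integrableOn_const (by simp)) ?_
  · exact eventually_mem_nhdsWithin.mono fun r hr => aestronglyMeasurable_logDerivRe ν hr
  · filter_upwards [eventually_mem_nhdsWithin,
      nhdsWithin_le_nhds (eventually_le_nhds (zero_lt_one (α := ℝ)))] with r hr hr1
    refine (ae_restrict_mem measurableSet_Ioo).mono fun θ hθ => ?_
    linarith [norm_logDerivRe_le hν hr hθ]
  · exact (ae_restrict_mem measurableSet_Ioo).mono fun θ hθ =>
      tendsto_logDerivRe_zero hν (cos_pos_of_abs_lt (abs_lt_of_mem_Ioo hθ)) (Real.cos_le_one θ)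

lemma tendsto_logDerivRe_sub_mul_atTop (hν : 0 ≤ ν) {c : ℝ} (hc : 0 < c) (hc1 : c ≤ 1) :
    Tendsto (fun r => logDerivRe ν r c - r * c) atTop (nhds (1 / 2)) := by
  rw [Metric.tendsto_nhds]
  intro δ hδ
  have hε : 0 < δ / (2 * (ν + 1)) := by positivity
  set ε := δ / (2 * (ν + 1)) with hε_def
  have h1 : ν * ε < δ / 2 := by
    rw [hε_def, ← mul_div_assoc, div_lt_div_iff₀ (by positivity) two_pos]
    nlinarith
  filter_upwards [eventually_gt_atTop 0,
    eventually_gt_atTop (((5 + ν / ε) * (1 + ν) + 1) / c / (δ / 2))] with r hr hr2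
  have h2 : ((5 + ν / ε) * (1 + ν) + 1) / (r * c) < δ / 2 := by
    rw [div_lt_iff₀ (by positivity), div_lt_iff₀ hc] at hr2
    rw [div_lt_iff₀ (by positivity)]
    linarith
  rw [Real.dist_eq]
  linarith [abs_logDerivRe_sub_sub_half_le hν hr hc hc1 hε]

lemma tendsto_angularIntegral_sub_atTop (hν : 0 ≤ ν) :
    Tendsto (fun r => angularIntegral ν r - r) atTop (nhds (π / 4)) := by
  have hπ := half_pos Real.pi_pos
  have e : ∫ _ in Ioo 0 (π / 2), (1 / 2 : ℝ) = π / 4 := by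
    simp [hπ.le]
    ring
  have hcos : IntegrableOn Real.cos (Ioo 0 (π / 2)) :=
    (Real.continuous_cos.integrableOn_Icc (a := 0) (b := π / 2)).mono_set Ioo_subset_Icc_self
  have e2 : ∫ θ in Ioo 0 (π / 2), Real.cos θ = 1 := by
    rw [← integral_Ioc_eq_integral_Ioo, ← intervalIntegral.integral_of_le hπ.le]
    simp
  have h : Tendsto (fun r => ∫ θ in Ioo 0 (π / 2), (logDerivRe ν r (Real.cos θ) - r * Real.cos θ))
      atTop (nhds (∫ _ in Ioo 0 (π / 2), (1 / 2 : ℝ))) := by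
    refine tendsto_integral_filter_of_dominated_convergence (fun _ => 2 + ν) ?_ ?_
      (integrableOn_const (by simp)) ?_
    · exact (eventually_gt_atTop 0).mono fun r hr => (aestronglyMeasurable_logDerivRe ν hr).sub
        (by fun_prop)
    · refine (eventually_gt_atTop 0).mono fun r hr =>
        (ae_restrict_mem measurableSet_Ioo).mono fun θ hθ => ?_
      have hc := cos_pos_of_abs_lt (abs_lt_of_mem_Ioo hθ)
      have h1 := mul_le_logDerivRe hν hr hc (Real.cos_le_one θ)
      have h2 := logDerivRe_le hν hr hc (Real.cos_le_one θ)
      rw [Real.norm_of_nonneg (by linarith)]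
      linarith
    · exact (ae_restrict_mem measurableSet_Ioo).mono fun θ hθ =>
        tendsto_logDerivRe_sub_mul_atTop hν (cos_pos_of_abs_lt (abs_lt_of_mem_Ioo hθ))
          (Real.cos_le_one θ)
  rw [e] at h
  refine h.congr' ((eventually_gt_atTop 0).mono fun r hr => ?_)
  rw [integral_sub (integrableOn_logDerivRe hν hr) (hcos.const_mul r),
    MeasureTheory.integral_const_mul, e2, mul_one]
  rfl

lemma setIntegral_Iic_div_M2_exp (hν : 0 ≤ ν) (ρ : ℝ) :
    ∫ s in Iic ρ, 2 / π / M2 ν (Real.exp s) =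
      angularIntegral ν (Real.exp ρ) - ν * (π / 2) := by
  have hpos : ∀ s, 0 ≤ 2 / π / M2 ν (Real.exp s) := fun s =>
    div_nonneg (by positivity) (mul_pos (by positivity) (nicholsonN_pos ν (Real.exp_pos s))).le
  have h : Tendsto (fun s => ∫ x in s..ρ, 2 / π / M2 ν (Real.exp x)) atBot
      (nhds (angularIntegral ν (Real.exp ρ) - ν * (π / 2))) := by
    have h1 := (tendsto_angularIntegral_zero hν).comp Real.tendsto_exp_atBot_nhdsGT
    refine (h1.const_sub (angularIntegral ν (Real.exp ρ))).congr' ?_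
    exact (eventually_le_atBot ρ).mono fun s hs => (integral_div_M2_exp hν hs).symm
  have hi : IntegrableOn (fun s => 2 / π / M2 ν (Real.exp s)) (Iic ρ) := by
    refine integrableOn_Iic_of_intervalIntegral_norm_tendsto
      (angularIntegral ν (Real.exp ρ) - ν * (π / 2)) ρ (fun s => ?_) tendsto_id ?_
    · exact ((monotone_div_M2_exp ν).intervalIntegrable (a := s) (b := ρ)).1
    · simpa only [Real.norm_of_nonneg (hpos _), id] using h
  exact tendsto_nhds_unique (intervalIntegral_tendsto_integral_Iic ρ hi tendsto_id) h

lemma phase_eq (hν : 0 ≤ ν) {z : ℝ} (hz : 0 < z) :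
    phase ν z = -(π / 2) + (angularIntegral ν z - ν * (π / 2)) := by
  have him : Real.exp '' Iic (Real.log z) = Ioc 0 z := by
    ext u
    constructor
    · rintro ⟨s, hs, rfl⟩
      exact ⟨Real.exp_pos s, (Real.le_log_iff_exp_le hz).1 hs⟩
    · rintro ⟨hu, huz⟩
      exact ⟨Real.log u, Real.log_le_log hu huz, Real.exp_log hu⟩
  have h := setIntegral_Iic_div_M2_exp hν (Real.log z)
  rw [Real.exp_log hz] at h
  rw [phase, intervalIntegral.integral_of_le hz.le, ← him,
    integral_image_eq_integral_abs_deriv_smul measurableSet_Iic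
      (fun s _ => (Real.hasDerivAt_exp s).hasDerivWithinAt) Real.exp_injective.injOn,
    ← h, ← MeasureTheory.integral_const_mul]
  congr 1
  refine setIntegral_congr_fun measurableSet_Iic fun s _ => ?_
  have he := Real.exp_pos s
  simp only [smul_eq_mul]
  rw [abs_of_pos he]
  field_simp

lemma tendsto_sqrt_sq_sub_sq_sub (ν : ℝ) :
    Tendsto (fun z => √(z ^ 2 - ν ^ 2) - z) atTop (nhds 0) := by
  have h1 : Tendsto (fun z : ℝ => -(ν ^ 2 / z)) atTop (nhds 0) := by
    simpa using (tendsto_const_nhds.div_atTop tendsto_id : Tendsto (fun z : ℝ => ν ^ 2 / z) atTop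
      (nhds 0)).neg
  refine tendsto_of_tendsto_of_tendsto_of_le_of_le' h1 tendsto_const_nhds ?_ ?_
  · filter_upwards [eventually_gt_atTop 0, eventually_ge_atTop |ν|] with z hz hz2
    have h2 : ν ^ 2 ≤ z ^ 2 := sq_le_sq.2 (hz2.trans (le_abs_self z))
    have h3 : z - ν ^ 2 / z ≤ √(z ^ 2 - ν ^ 2) := by
      refine Real.le_sqrt_of_sq_le ?_
      have e : (z - ν ^ 2 / z) ^ 2 = z ^ 2 - ν ^ 2 - ν ^ 2 * (z ^ 2 - ν ^ 2) / z ^ 2 := by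
        field_simp
      have : 0 ≤ ν ^ 2 * (z ^ 2 - ν ^ 2) / z ^ 2 :=
        div_nonneg (mul_nonneg (sq_nonneg ν) (by linarith)) (sq_nonneg z)
      linarith
    linarith
  · filter_upwards [eventually_gt_atTop 0] with z hz
    have : √(z ^ 2 - ν ^ 2) ≤ z := Real.sqrt_le_iff.2 ⟨hz.le, by linarith [sq_nonneg ν]⟩
    linarith

end

/-- For each fixed `ν ≥ 0`, `B(z,ν) − A(z,ν) → 0` as `z → ∞`. -/
theorem B_sub_A_tendsto_zero (ν : ℝ) (hν : 0 ≤ ν) :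
    Tendsto (fun z => B z ν - A z ν) atTop (nhds 0) := by
  have h1 := tendsto_sqrt_sq_sub_sq_sub ν
  have h2 : Tendsto (fun z : ℝ => Real.arccos (ν / z)) atTop (nhds (π / 2)) := by
    have := (Real.continuous_arccos.tendsto 0).comp
      (tendsto_const_nhds.div_atTop tendsto_id : Tendsto (fun z : ℝ => ν / z) atTop (nhds 0))
    simpa [Function.comp_def] using this
  have h3 := tendsto_angularIntegral_sub_atTop hν
  have h4 := (((h1.sub ((h2.sub_const (π / 2)).const_mul ν)).sub
    (h3.sub_const (π / 4))).const_mul (1 / π))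
  simp only [sub_self, mul_zero] at h4
  refine h4.congr' ((eventually_gt_atTop 0).mono fun z hz => ?_)
  simp only [A, B, phase_eq hν hz]
  field_simp
  ring
end

section
/- Let D ⊆ ℝ² be the region D := {(x,y) : −1 ≤ x ≤ 1, max(0,−x) ≤ y ≤ (1/π)(√(1−x²) − x·arccos x)}. Then for every λ > 0 and every integer n with |n| ≤ λ, the number of integers k such that (n, k − 1/4) ∈ λ·D equals ⌊B(λ,|n|)⌋, where B(z,ν) := (1/π)(√(z² − ν²) − ν·arccos(ν/z)) + 1/4. -/
open Real Set Pointwise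

/-- The region `D` appearing in the lattice point problem for the disk. -/
noncomputable def Dregion : Set (ℝ × ℝ) :=
  {p | -1 ≤ p.1 ∧ p.1 ≤ 1 ∧ max 0 (-p.1) ≤ p.2 ∧
       p.2 ≤ (1 / π) * (Real.sqrt (1 - p.1 ^ 2) - p.1 * Real.arccos p.1)}

/-- `x arccos x ≤ √(1 - x²)` on `[0, 1]`, i.e. `θ cos θ ≤ sin θ` for `θ ∈ [0, π/2]`. -/
theorem mul_arccos_le_sqrt {x : ℝ} (h0 : 0 ≤ x) (h1 : x ≤ 1) :
    x * Real.arccos x ≤ Real.sqrt (1 - x ^ 2) := by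
  rcases h0.eq_or_lt with rfl | hpos
  · simp
  · have h := Real.le_tan (Real.arccos_nonneg x) (Real.arccos_lt_pi_div_two.2 hpos)
    rw [Real.tan_arccos, le_div_iff₀ hpos] at h
    linarith

theorem mul_sqrt_one_sub_div_sq {z : ℝ} (hz : 0 < z) (ν : ℝ) :
    z * Real.sqrt (1 - (ν / z) ^ 2) = Real.sqrt (z ^ 2 - ν ^ 2) := by
  have h : z ^ 2 - ν ^ 2 = z ^ 2 * (1 - (ν / z) ^ 2) := by
    field_simp
  rw [h, Real.sqrt_mul (sq_nonneg z), Real.sqrt_sq hz.le]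

theorem B_pos {z ν : ℝ} (hz : 0 < z) (hν : 0 ≤ ν) (h : ν ≤ z) : 0 < B z ν := by
  have h1 := mul_arccos_le_sqrt (div_nonneg hν hz.le) ((div_le_one hz).2 h)
  have h2 := mul_le_mul_of_nonneg_left h1 hz.le
  rw [mul_sqrt_one_sub_div_sq hz, ← mul_assoc, mul_div_cancel₀ _ hz.ne'] at h2
  have h3 : 0 ≤ (1 / π) * (Real.sqrt (z ^ 2 - ν ^ 2) - ν * Real.arccos (ν / z)) :=
    mul_nonneg (by positivity) (sub_nonneg.2 h2)
  unfold B
  linarith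

/-- The upper boundary of `z • D` above `ν`, in terms of `B`. -/
theorem mul_upper_boundary_eq {z : ℝ} (hz : 0 < z) (ν : ℝ) :
    z * ((1 / π) * (Real.sqrt (1 - (ν / z) ^ 2) - ν / z * Real.arccos (ν / z)))
      = max 0 (-ν) + B z |ν| - 1 / 4 := by
  have h : z * ((1 / π) * (Real.sqrt (1 - (ν / z) ^ 2) - ν / z * Real.arccos (ν / z)))
      = (1 / π) * (Real.sqrt (z ^ 2 - ν ^ 2) - ν * Real.arccos (ν / z)) := by
    rw [← mul_sqrt_one_sub_div_sq hz]
    field_simp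
  rw [h, B, sq_abs]
  rcases le_total 0 ν with h0 | h0
  · rw [abs_of_nonneg h0, max_eq_left (by linarith)]
    ring
  · rw [abs_of_nonpos h0, max_eq_right (by linarith), neg_div, Real.arccos_neg]
    field_simp
    ring

theorem mem_smul_Dregion_iff {z : ℝ} (hz : 0 < z) {ν : ℝ} (hν : |ν| ≤ z) (y : ℝ) :
    (ν, y) ∈ z • Dregion ↔ max 0 (-ν) ≤ y ∧ y ≤ max 0 (-ν) + B z |ν| - 1 / 4 := by
  obtain ⟨h1, h2⟩ := abs_le.1 hν
  rw [Set.mem_smul_set_iff_inv_smul_mem₀ hz.ne', ← mul_upper_boundary_eq hz]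
  have hx : z⁻¹ * ν = ν / z := by ring
  have hy : z⁻¹ * y = y / z := by ring
  have hm : max 0 (-(ν / z)) ≤ y / z ↔ max 0 (-ν) ≤ y := by
    rw [max_le_iff, max_le_iff, ← neg_div, div_le_div_iff_of_pos_right hz,
      le_div_iff₀ hz, zero_mul]
  simp only [Dregion, Set.mem_ofPred_eq, Prod.smul_mk, smul_eq_mul, hx, hy, hm]
  rw [le_div_iff₀ hz, div_le_one hz, div_le_iff₀' hz]
  constructor
  · exact fun h => h.2.2
  · exact fun h => ⟨by linarith, h2, h⟩

/-- For `λ > 0` and an integer `n` with `|n| ≤ λ`, the number of integers `k` with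
`(n, k − 1/4) ∈ λ·D` equals `⌊B(λ,|n|)⌋`. -/
theorem column_count_eq_floor_B (lam : ℝ) (hlam : 0 < lam) (n : ℤ)
    (hn : |(n : ℝ)| ≤ lam) :
    (Set.ncard {k : ℤ | ((n : ℝ), (k : ℝ) - 1 / 4) ∈ lam • Dregion} : ℤ)
      = ⌊B lam |(n : ℝ)|⌋ := by
  have hset : {k : ℤ | ((n : ℝ), (k : ℝ) - 1 / 4) ∈ lam • Dregion}
      = Set.Icc (max 0 (-n) + 1) (max 0 (-n) + ⌊B lam |(n : ℝ)|⌋) := by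
    ext k
    have hcast : max 0 (-(n : ℝ)) = ((max 0 (-n) : ℤ) : ℝ) := by push_cast; rfl
    rw [Set.mem_ofPred_eq, mem_smul_Dregion_iff hlam hn, hcast, Set.mem_Icc]
    generalize max 0 (-n) = m
    refine and_congr ⟨fun h => ?_, fun h => ?_⟩ ?_
    · have : (m : ℝ) < k := by linarith
      exact_mod_cast this
    · have : (m : ℝ) + 1 ≤ k := by exact_mod_cast h
      linarith
    · rw [← sub_le_iff_le_add', Int.le_floor]
      push_cast
      constructor <;> intro h <;> linarith
  have hB : 0 ≤ ⌊B lam |(n : ℝ)|⌋ := Int.floor_nonneg.2 (B_pos hlam (abs_nonneg _) hn).le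
  rw [hset, ← Finset.coe_Icc, Set.ncard_coe_finset, Int.card_Icc]
  omega
end
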